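/- arXiv:2102.10687 — 9 statements merged into one kernel-verified Lean document; each statement's English description precedes it below -/
import Mathlib

section
/- Fix an NSI n and nonnegative resource prices μ. If x_n and y_n both maximize the payoff Π_n(·; μ) over the nonnegative orthant, then x_{n,l} = y_{n,l} for every area l; that is, the optimal area traffic volume of each NSI is uniquely determined by the prices. -/
open Finset

/-- The traffic volume of the path-allocation `xn` in area `l`. -/
noncomputable def areaVol {A P : Type*} [Fintype P] [DecidableEq A] (area : P → A)
    (xn : P → ℝ) (l : A) : ℝ :=
  ∑ p ∈ Finset.univ.filter (fun p => area p = l), xn p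

/-- The per-unit cost `c^n_p(μ)` of path `p` under resource prices `μ`. -/
noncomputable def pathCost {I R P : Type*} [Fintype R] (nodes : P → Finset I)
    (d : P → I → R → ℝ) (μ : I → R → ℝ) (p : P) : ℝ :=
  ∑ i ∈ nodes p, ∑ r, d p i r * μ i r

/-- The total load `Σ_n Σ_{p : i ∈ p} x_n^p d^p_{n,i,r}` on resource `r` of node `i`. -/
noncomputable def nodeLoad {N I R P : Type*} [Fintype N] [Fintype P] [DecidableEq I]
    (nodes : P → Finset I) (d : N → P → I → R → ℝ) (x : N → P → ℝ)
    (i : I) (r : R) : ℝ :=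
  ∑ n, ∑ p ∈ Finset.univ.filter (fun p => i ∈ nodes p), x n p * d n p i r

/-- Feasibility of an allocation: nonnegativity and the capacity constraints. -/
def FeasibleAlloc {N I R P : Type*} [Fintype N] [Fintype P] [DecidableEq I]
    (nodes : P → Finset I) (d : N → P → I → R → ℝ) (C : I → R → ℝ)
    (x : N → P → ℝ) : Prop :=
  (∀ n p, 0 ≤ x n p) ∧ ∀ i r, nodeLoad nodes d x i r ≤ C i r

/-- The payoff `Π_n(x_n; μ)` of a single NSI with utilities `U` and demands `d`. -/
noncomputable def payoffNSI {A I R P : Type*} [Fintype A] [Fintype P] [Fintype R]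
    [DecidableEq A] (area : P → A) (nodes : P → Finset I) (U : A → ℝ → ℝ)
    (d : P → I → R → ℝ) (μ : I → R → ℝ) (xn : P → ℝ) : ℝ :=
  (∑ l, U l (areaVol area xn l)) -
    ∑ l, ∑ p ∈ Finset.univ.filter (fun p => area p = l),
      xn p * pathCost nodes d μ p

/-- `xn` maximizes the payoff over the nonnegative orthant (Problem 2). -/
def MaximizesPayoff {A I R P : Type*} [Fintype A] [Fintype P] [Fintype R] [DecidableEq A]
    (area : P → A) (nodes : P → Finset I) (U : A → ℝ → ℝ) (d : P → I → R → ℝ)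
    (μ : I → R → ℝ) (xn : P → ℝ) : Prop :=
  (∀ p, 0 ≤ xn p) ∧
    ∀ y : P → ℝ, (∀ p, 0 ≤ y p) →
      payoffNSI area nodes U d μ y ≤ payoffNSI area nodes U d μ xn

/-- The objective of Problem 1 (social welfare minus OPEX). -/
noncomputable def obj1 {N A I R P : Type*} [Fintype N] [Fintype A] [Fintype I] [Fintype R]
    [Fintype P] [DecidableEq A] [DecidableEq I] (area : P → A) (nodes : P → Finset I)
    (U : N → A → ℝ → ℝ) (d : N → P → I → R → ℝ) (q : I → R → ℝ)
    (x : N → P → ℝ) : ℝ :=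
  (∑ n, ∑ l, U n l (areaVol area (x n) l)) -
    ∑ i, ∑ r, q i r * nodeLoad nodes d x i r

/-- Nash equilibrium of the distributed resource provisioning game. -/
def IsNE {N A I R P : Type*} [Fintype N] [Fintype A] [Fintype P] [Fintype R]
    [DecidableEq A] [DecidableEq I] (area : P → A) (nodes : P → Finset I)
    (U : N → A → ℝ → ℝ) (d : N → P → I → R → ℝ) (C q : I → R → ℝ)
    (x : N → P → ℝ) (μ : I → R → ℝ) : Prop :=
  FeasibleAlloc nodes d C x ∧ (∀ i r, 0 ≤ μ i r) ∧ (∀ i r, q i r ≤ μ i r) ∧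
    (∀ i r, q i r < μ i r → nodeLoad nodes d x i r = C i r) ∧
    ∀ n, MaximizesPayoff area nodes (U n) (d n) μ (x n)

/-- The objective of Problem 3 (weighted proportional fairness minus OPEX). -/
noncomputable def obj3 {N A I R P : Type*} [Fintype N] [Fintype A] [Fintype I] [Fintype R]
    [Fintype P] [DecidableEq A] [DecidableEq I] (area : P → A) (nodes : P → Finset I)
    (d : N → P → I → R → ℝ) (q : I → R → ℝ) (w : N → A → ℝ)
    (x : N → P → ℝ) : ℝ :=
  (∑ n, ∑ l, w n l * Real.log (areaVol area (x n) l)) -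
    ∑ i, ∑ r, q i r * nodeLoad nodes d x i r

/-- The maximum traffic volume that an NSI with demands `d` can process in area `l`
using the resource bundle `a`. -/
noncomputable def Tvol {A I R P : Type*} [Fintype P] [DecidableEq A] [DecidableEq I]
    (area : P → A) (nodes : P → Finset I) (d : P → I → R → ℝ) (l : A)
    (a : I → R → ℝ) : ℝ :=
  sSup {s : ℝ | ∃ t : P → ℝ, (∀ p, 0 ≤ t p) ∧
    (∀ i r, (∑ p ∈ Finset.univ.filter (fun p => i ∈ nodes p ∧ area p = l),
        t p * d p i r) ≤ a i r) ∧
    s = ∑ p ∈ Finset.univ.filter (fun p => area p = l), t p}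

theorem statement3 {N A I R P : Type*} [Fintype N] [Fintype A] [Fintype I] [Fintype R] [Fintype P]
    [Nonempty N] [Nonempty A] [Nonempty I] [Nonempty R]
    [DecidableEq A] [DecidableEq I]
    (area : P → A) (nodes : P → Finset I)
    (d : N → P → I → R → ℝ) (C q : I → R → ℝ)
    (U U' : N → A → ℝ → ℝ)
    (hP : ∀ l : A, ∃ p : P, area p = l)
    (hd : ∀ n p i r, 0 ≤ d n p i r)
    (hC : ∀ i r, 0 < C i r)
    (hq : ∀ i r, 0 ≤ q i r)
    (hU : ∀ n l, StrictConcaveOn ℝ (Set.Ici (0 : ℝ)) (U n l))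
    (hU' : ∀ n l z, (0 : ℝ) ≤ z → HasDerivWithinAt (U n l) (U' n l z) (Set.Ici 0) z)
    (hU'c : ∀ n l, ContinuousOn (U' n l) (Set.Ici 0))
    (n : N) (μ : I → R → ℝ) (hμ : ∀ i r, 0 ≤ μ i r)
    (xn yn : P → ℝ)
    (hx : MaximizesPayoff area nodes (U n) (d n) μ xn)
    (hy : MaximizesPayoff area nodes (U n) (d n) μ yn) :
    ∀ l : A, areaVol area xn l = areaVol area yn l := by
  intro l
  by_contra hne
  obtain ⟨hx0, hxm⟩ := hx
  obtain ⟨hy0, hym⟩ := hy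
  have hv : ∀ k, areaVol area (fun p => (1/2 : ℝ) * xn p + (1/2 : ℝ) * yn p) k
      = (1/2 : ℝ) * areaVol area xn k + (1/2 : ℝ) * areaVol area yn k := by
    intro k
    simp only [areaVol, Finset.sum_add_distrib, Finset.mul_sum]
  have hvx : ∀ k, areaVol area xn k ∈ Set.Ici (0 : ℝ) := fun k =>
    Finset.sum_nonneg (fun p _ => hx0 p)
  have hvy : ∀ k, areaVol area yn k ∈ Set.Ici (0 : ℝ) := fun k =>
    Finset.sum_nonneg (fun p _ => hy0 p)
  have hz0 : ∀ p, 0 ≤ (1/2 : ℝ) * xn p + (1/2 : ℝ) * yn p := by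
    intro p
    linarith [hx0 p, hy0 p]
  have h1 := hxm _ hz0
  have h2 := hym _ hz0
  have hU1 : ∑ k, ((1/2 : ℝ) * U n k (areaVol area xn k) + (1/2 : ℝ) * U n k (areaVol area yn k))
      < ∑ k, U n k (areaVol area (fun p => (1/2 : ℝ) * xn p + (1/2 : ℝ) * yn p) k) := by
    apply Finset.sum_lt_sum
    · intro k _
      rw [hv k]
      have := (hU n k).concaveOn.2 (hvx k) (hvy k)
        (by norm_num : (0:ℝ) ≤ 1/2) (by norm_num : (0:ℝ) ≤ 1/2) (by norm_num)
      simpa only [smul_eq_mul] using this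
    · refine ⟨l, Finset.mem_univ l, ?_⟩
      rw [hv l]
      have := (hU n l).2 (hvx l) (hvy l) hne
        (by norm_num : (0:ℝ) < 1/2) (by norm_num : (0:ℝ) < 1/2) (by norm_num)
      simpa only [smul_eq_mul] using this
  have hc : ∑ k, ∑ p ∈ Finset.univ.filter (fun p => area p = k),
      ((1/2 : ℝ) * xn p + (1/2 : ℝ) * yn p) * pathCost nodes (d n) μ p
      = (1/2 : ℝ) * (∑ k, ∑ p ∈ Finset.univ.filter (fun p => area p = k),
          xn p * pathCost nodes (d n) μ p)
        + (1/2 : ℝ) * (∑ k, ∑ p ∈ Finset.univ.filter (fun p => area p = k),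
          yn p * pathCost nodes (d n) μ p) := by
    simp only [Finset.mul_sum, ← Finset.sum_add_distrib, add_mul, mul_assoc]
  rw [Finset.sum_add_distrib, ← Finset.mul_sum, ← Finset.mul_sum] at hU1
  unfold payoffNSI at h1 h2
  rw [hc] at h1 h2
  linarith
end

section
/- (Theorem 1) A feasible allocation x forms a Nash equilibrium (x, μ) together with some nonnegative prices μ if and only if x is an optimal solution of Problem 1. -/
open Finset

/-- Lagrange duality under the Slater condition. -/
theorem slater_duality {E J : Type*} [AddCommGroup E] [Module ℝ E] [Fintype J]
    (S : Set E) (f : E → ℝ) (hf : ConcaveOn ℝ S f) (g : J → E → ℝ)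
    (hg : ∀ j, ConcaveOn ℝ S (g j)) (x z : E) (hx : x ∈ S) (hz : z ∈ S)
    (hgx : ∀ j, 0 ≤ g j x) (hgz : ∀ j, 0 < g j z)
    (hopt : ∀ y ∈ S, (∀ j, 0 ≤ g j y) → f y ≤ f x) :
    ∃ ν : J → ℝ, (∀ j, 0 ≤ ν j) ∧ ∀ y ∈ S, f y + ∑ j, ν j * g j y ≤ f x := by
  classical
  let T : Set (ℝ × (J → ℝ)) := (Set.Ioi 0) ×ˢ (Set.pi Set.univ fun _ => Set.Ioi 0)
  let K : Set (ℝ × (J → ℝ)) := {w | ∃ y ∈ S, w.1 ≤ f y - f x ∧ ∀ j, w.2 j ≤ g j y}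
  have hTc : Convex ℝ T := (convex_Ioi 0).prod (convex_pi fun _ _ => convex_Ioi 0)
  have hTo : IsOpen T := isOpen_Ioi.prod (isOpen_set_pi Set.finite_univ fun _ _ => isOpen_Ioi)
  have hKc : Convex ℝ K := by
    rintro ⟨a1, a2⟩ ⟨y1, hy1, h1, h1'⟩ ⟨b1, b2⟩ ⟨y2, hy2, h2, h2'⟩ s t hs ht hst
    refine ⟨s • y1 + t • y2, hf.1 hy1 hy2 hs ht hst, ?_, fun j => ?_⟩
    · have h := hf.2 hy1 hy2 hs ht hst
      simp only [smul_eq_mul, Prod.smul_mk, Prod.mk_add_mk] at h h1 h2 ⊢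
      have e : f x = s * f x + t * f x := by rw [← add_mul, hst, one_mul]
      nlinarith [mul_le_mul_of_nonneg_left h1 hs, mul_le_mul_of_nonneg_left h2 ht]
    · have h := (hg j).2 hy1 hy2 hs ht hst
      have h1 := h1' j
      have h2 := h2' j
      simp only [smul_eq_mul, Prod.smul_mk, Prod.mk_add_mk, Pi.add_apply, Pi.smul_apply] at h h1 h2 ⊢
      nlinarith [mul_le_mul_of_nonneg_left h1 hs, mul_le_mul_of_nonneg_left h2 ht]
  have hdisj : Disjoint T K := by
    rw [Set.disjoint_left]
    rintro ⟨a, b⟩ ⟨ha, hb⟩ ⟨y, hy, h1, h2⟩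
    have := hopt y hy fun j => (le_of_lt (hb j trivial)).trans (h2 j)
    simp only [Set.mem_Ioi] at ha h1
    linarith
  obtain ⟨φ, u, hφT, hφK⟩ := geometric_hahn_banach_open hTc hTo hKc hdisj
  have hu0 : u ≤ 0 := by
    simpa using hφK 0 ⟨x, hx, by simp, by simpa using hgx⟩
  have hu1 : 0 ≤ u := by
    have hlim : Filter.Tendsto (fun t : ℝ => t * φ (1, fun _ => 1)) (nhdsWithin 0 (Set.Ioi 0))
        (nhds 0) := by
      have : Continuous (fun t : ℝ => t * φ (1, fun _ => 1)) := by fun_prop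
      simpa using (this.tendsto 0).mono_left nhdsWithin_le_nhds
    refine le_of_tendsto hlim ?_
    filter_upwards [self_mem_nhdsWithin] with t ht
    have := hφT (t • (1, fun _ => 1)) ⟨by simpa using ht, fun j _ => by simpa using ht⟩
    rw [map_smul, smul_eq_mul] at this
    exact this.le
  have hu : u = 0 := le_antisymm hu0 hu1
  subst hu
  let a : ℝ := -φ (1, 0)
  let b : J → ℝ := fun j => -φ (0, Pi.single j 1)
  have hφ : ∀ s v, φ (s, v) = -(a * s + ∑ j, b j * v j) := by
    intro s v
    have e : ((s, v) : ℝ × (J → ℝ)) = s • (1, 0) + ∑ j, v j • (0, Pi.single j 1) := by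
      ext k
      · simp [Prod.fst_sum]
      · simp [Prod.snd_sum, Finset.sum_apply, Pi.single_apply]
    rw [e, map_add, map_sum]
    simp only [map_smul, smul_eq_mul, a, b, neg_mul, Finset.sum_neg_distrib]
    rw [neg_add, neg_neg, neg_neg, mul_comm]
    congr 1
    exact Finset.sum_congr rfl fun j _ => mul_comm _ _
  have ha : 0 ≤ a := by
    have := hφK (-1, 0) ⟨x, hx, by simp, by simpa using hgx⟩
    rw [hφ] at this
    simp at this
    linarith
  have hb : ∀ j, 0 ≤ b j := by
    intro j
    have := hφK (0, -Pi.single j 1) ⟨x, hx, by simp, fun k => by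
      refine le_trans ?_ (hgx k)
      by_cases h : k = j
      · subst h; simp
      · simp [Pi.single_apply, h]⟩
    rw [hφ] at this
    simp [Pi.single_apply] at this
    linarith
  have hK : ∀ y ∈ S, a * (f y - f x) + ∑ j, b j * g j y ≤ 0 := by
    intro y hy
    have := hφK (f y - f x, fun j => g j y) ⟨y, hy, le_rfl, fun j => le_rfl⟩
    rw [hφ] at this
    linarith
  have ha' : 0 < a := by
    rcases ha.lt_or_eq with h | h
    · exact h
    exfalso
    have h1 := hK z hz
    rw [← h, zero_mul, zero_add] at h1
    have h2 : ∑ j, b j * g j z = 0 :=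
      le_antisymm h1 (Finset.sum_nonneg fun j _ => mul_nonneg (hb j) (hgz j).le)
    rw [Finset.sum_eq_zero_iff_of_nonneg
      (fun j _ => mul_nonneg (hb j) (hgz j).le)] at h2
    have h3 : ∀ j, b j = 0 := fun j =>
      (mul_eq_zero.1 (h2 j (Finset.mem_univ j))).resolve_right (hgz j).ne'
    have h4 := hφT (1, fun _ => 1) ⟨by simp, fun j _ => by simp⟩
    rw [hφ, ← h] at h4
    simp [h3] at h4
  refine ⟨fun j => b j / a, fun j => div_nonneg (hb j) ha, fun y hy => ?_⟩
  have h := hK y hy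
  have e : ∑ j, b j / a * g j y = (∑ j, b j * g j y) / a := by
    rw [Finset.sum_div]
    exact Finset.sum_congr rfl fun j _ => by ring
  rw [e]
  have : (∑ j, b j * g j y) / a ≤ f x - f y := by
    rw [div_le_iff₀ ha']; linarith
  linarith

theorem sum_price_load {N I R P : Type*} [Fintype N] [Fintype I] [Fintype R]
    [Fintype P] [DecidableEq I] (nodes : P → Finset I)
    (d : N → P → I → R → ℝ) (μ : I → R → ℝ) (y : N → P → ℝ) :
    ∑ i, ∑ r, μ i r * nodeLoad nodes d y i r =
      ∑ n, ∑ p, y n p * pathCost nodes (d n) μ p := by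
  have h1 : ∀ n p, y n p * pathCost nodes (d n) μ p =
      ∑ i, ∑ r, if i ∈ nodes p then μ i r * (y n p * d n p i r) else 0 := by
    intro n p
    unfold pathCost
    rw [← Finset.sum_subset (Finset.subset_univ (nodes p))]
    · rw [Finset.mul_sum]
      refine Finset.sum_congr rfl fun i hi => ?_
      rw [Finset.mul_sum]
      refine Finset.sum_congr rfl fun r _ => ?_
      rw [if_pos hi]; ring
    · intro i _ hi
      simp [hi]
  have h2 : ∀ i r, μ i r * nodeLoad nodes d y i r =
      ∑ n, ∑ p, if i ∈ nodes p then μ i r * (y n p * d n p i r) else 0 := by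
    intro i r
    unfold nodeLoad
    rw [Finset.mul_sum]
    refine Finset.sum_congr rfl fun n _ => ?_
    rw [Finset.mul_sum, Finset.sum_filter]
  simp only [h1, h2]
  calc _ = ∑ i, ∑ n, ∑ r, ∑ p, (if i ∈ nodes p then μ i r * (y n p * d n p i r) else 0) :=
        Finset.sum_congr rfl fun i _ => Finset.sum_comm
    _ = ∑ n, ∑ i, ∑ r, ∑ p, (if i ∈ nodes p then μ i r * (y n p * d n p i r) else 0) :=
        Finset.sum_comm
    _ = ∑ n, ∑ i, ∑ p, ∑ r, (if i ∈ nodes p then μ i r * (y n p * d n p i r) else 0) :=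
        Finset.sum_congr rfl fun n _ => Finset.sum_congr rfl fun i _ => Finset.sum_comm
    _ = _ := Finset.sum_congr rfl fun n _ => Finset.sum_comm

theorem obj1_eq_sum_payoff {N A I R P : Type*} [Fintype N] [Fintype A] [Fintype I] [Fintype R]
    [Fintype P] [DecidableEq A] [DecidableEq I] (area : P → A) (nodes : P → Finset I)
    (U : N → A → ℝ → ℝ) (d : N → P → I → R → ℝ) (μ : I → R → ℝ)
    (y : N → P → ℝ) :
    obj1 area nodes U d μ y = ∑ n, payoffNSI area nodes (U n) (d n) μ (y n) := by
  unfold obj1 payoffNSI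
  rw [Finset.sum_sub_distrib, sum_price_load]
  congr 1
  refine Finset.sum_congr rfl fun n _ => ?_
  exact (Finset.sum_fiberwise _ _ _).symm

theorem obj1_price_change {N A I R P : Type*} [Fintype N] [Fintype A] [Fintype I] [Fintype R]
    [Fintype P] [DecidableEq A] [DecidableEq I] (area : P → A) (nodes : P → Finset I)
    (U : N → A → ℝ → ℝ) (d : N → P → I → R → ℝ) (q μ : I → R → ℝ)
    (y : N → P → ℝ) :
    obj1 area nodes U d q y = obj1 area nodes U d μ y +
      ∑ i, ∑ r, (μ i r - q i r) * nodeLoad nodes d y i r := by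
  unfold obj1
  simp only [sub_mul, Finset.sum_sub_distrib]
  ring

theorem nodeLoad_combo {N I R P : Type*} [Fintype N] [Fintype P] [DecidableEq I]
    (nodes : P → Finset I) (d : N → P → I → R → ℝ) (y z : N → P → ℝ) (s t : ℝ)
    (i : I) (r : R) : nodeLoad nodes d (s • y + t • z) i r =
      s * nodeLoad nodes d y i r + t * nodeLoad nodes d z i r := by
  unfold nodeLoad
  simp only [Finset.mul_sum, ← Finset.sum_add_distrib]
  refine Finset.sum_congr rfl fun n _ => Finset.sum_congr rfl fun p _ => ?_
  simp only [Pi.add_apply, Pi.smul_apply, smul_eq_mul]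
  ring

theorem areaVol_combo {A P : Type*} [Fintype P] [DecidableEq A] (area : P → A)
    (y z : P → ℝ) (s t : ℝ) (l : A) : areaVol area (s • y + t • z) l =
      s * areaVol area y l + t * areaVol area z l := by
  unfold areaVol
  simp only [Finset.mul_sum, ← Finset.sum_add_distrib]
  rfl

theorem obj1_concave {N A I R P : Type*} [Fintype N] [Fintype A] [Fintype I] [Fintype R]
    [Fintype P] [DecidableEq A] [DecidableEq I] (area : P → A) (nodes : P → Finset I)
    (U : N → A → ℝ → ℝ) (d : N → P → I → R → ℝ) (q : I → R → ℝ)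
    (hU : ∀ n l, ConcaveOn ℝ (Set.Ici (0 : ℝ)) (U n l))
    (S : Set (N → P → ℝ)) (hS : Convex ℝ S) (hS0 : ∀ y ∈ S, ∀ n p, 0 ≤ y n p) :
    ConcaveOn ℝ S (obj1 area nodes U d q) := by
  refine ⟨hS, fun y hy z hz s t hs ht hst => ?_⟩
  have hA : ∀ y ∈ S, ∀ n l, 0 ≤ areaVol area (y n) l := fun y hy n l =>
    Finset.sum_nonneg fun p _ => hS0 y hy n p
  have h1 : ∑ n, ∑ l, (s * U n l (areaVol area (y n) l) + t * U n l (areaVol area (z n) l)) ≤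
      ∑ n, ∑ l, U n l (areaVol area ((s • y + t • z) n) l) := by
    refine Finset.sum_le_sum fun n _ => Finset.sum_le_sum fun l _ => ?_
    have := (hU n l).2 (hA y hy n l) (hA z hz n l) hs ht hst
    simp only [smul_eq_mul] at this
    have e := areaVol_combo area (y n) (z n) s t l
    rw [← e] at this
    exact this
  have h2 : ∑ i, ∑ r, q i r * nodeLoad nodes d (s • y + t • z) i r =
      s * (∑ i, ∑ r, q i r * nodeLoad nodes d y i r) +
      t * (∑ i, ∑ r, q i r * nodeLoad nodes d z i r) := by
    simp only [nodeLoad_combo, Finset.mul_sum, ← Finset.sum_add_distrib]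
    exact Finset.sum_congr rfl fun i _ => Finset.sum_congr rfl fun r _ => by ring
  simp only [Finset.sum_add_distrib, ← Finset.mul_sum] at h1
  unfold obj1
  rw [h2]
  simp only [smul_eq_mul]
  linarith

theorem statement4 {N A I R P : Type*} [Fintype N] [Fintype A] [Fintype I] [Fintype R] [Fintype P]
    [Nonempty N] [Nonempty A] [Nonempty I] [Nonempty R]
    [DecidableEq A] [DecidableEq I]
    (area : P → A) (nodes : P → Finset I)
    (d : N → P → I → R → ℝ) (C q : I → R → ℝ)
    (U U' : N → A → ℝ → ℝ)
    (hP : ∀ l : A, ∃ p : P, area p = l)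
    (hd : ∀ n p i r, 0 ≤ d n p i r)
    (hC : ∀ i r, 0 < C i r)
    (hq : ∀ i r, 0 ≤ q i r)
    (hU : ∀ n l, StrictConcaveOn ℝ (Set.Ici (0 : ℝ)) (U n l))
    (hU' : ∀ n l z, (0 : ℝ) ≤ z → HasDerivWithinAt (U n l) (U' n l z) (Set.Ici 0) z)
    (hU'c : ∀ n l, ContinuousOn (U' n l) (Set.Ici 0))
    (x : N → P → ℝ) (hx : FeasibleAlloc nodes d C x) :
    (∃ μ : I → R → ℝ, (∀ i r, 0 ≤ μ i r) ∧ IsNE area nodes U d C q x μ) ↔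
      ∀ y : N → P → ℝ, FeasibleAlloc nodes d C y →
        obj1 area nodes U d q y ≤ obj1 area nodes U d q x := by
  classical
  constructor
  · rintro ⟨μ, -, -, -, hμq, hcs, hmax⟩ y hy
    rw [obj1_price_change area nodes U d q μ y, obj1_price_change area nodes U d q μ x,
      obj1_eq_sum_payoff, obj1_eq_sum_payoff]
    refine add_le_add (Finset.sum_le_sum fun n _ => (hmax n).2 (y n) (hy.1 n))
      (Finset.sum_le_sum fun i _ => Finset.sum_le_sum fun r _ => ?_)
    rcases (hμq i r).lt_or_eq with h | h
    · rw [hcs i r h]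
      exact mul_le_mul_of_nonneg_left (hy.2 i r) (sub_nonneg.2 h.le)
    · simp [h]
  · intro hopt
    let S : Set (N → P → ℝ) := {y | ∀ n p, 0 ≤ y n p}
    have hS : Convex ℝ S := by
      intro y hy z hz s t hs ht _ n p
      exact add_nonneg (mul_nonneg hs (hy n p)) (mul_nonneg ht (hz n p))
    obtain ⟨ν, hν, hdual⟩ := slater_duality S (obj1 area nodes U d q)
      (obj1_concave area nodes U d q (fun n l => (hU n l).concaveOn) S hS fun y hy => hy)
      (fun (j : I × R) y => C j.1 j.2 - nodeLoad nodes d y j.1 j.2)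
      (fun j => ⟨hS, fun y _ z _ s t _ _ hst => by
        simp only [nodeLoad_combo, smul_eq_mul]
        have e : C j.1 j.2 = s * C j.1 j.2 + t * C j.1 j.2 := by rw [← add_mul, hst, one_mul]
        linarith⟩)
      x 0 hx.1 (fun n p => le_rfl) (fun j => sub_nonneg.2 (hx.2 j.1 j.2))
      (fun j => by simpa [nodeLoad] using hC j.1 j.2)
      (fun y hy hg => hopt y ⟨hy, fun i r => sub_nonneg.1 (hg (i, r))⟩)
    have hcs : ∀ j : I × R, ν j * (C j.1 j.2 - nodeLoad nodes d x j.1 j.2) = 0 := by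
      have hnn : ∀ j ∈ (Finset.univ : Finset (I × R)),
          0 ≤ ν j * (C j.1 j.2 - nodeLoad nodes d x j.1 j.2) := fun j _ =>
        mul_nonneg (hν j) (sub_nonneg.2 (hx.2 j.1 j.2))
      have h1 := hdual x hx.1
      have h2 := (Finset.sum_eq_zero_iff_of_nonneg hnn).1
        (le_antisymm (by linarith) (Finset.sum_nonneg hnn))
      exact fun j => h2 j (Finset.mem_univ j)
    let μ : I → R → ℝ := fun i r => q i r + ν (i, r)
    have hμ0 : ∀ i r, 0 ≤ μ i r := fun i r => add_nonneg (hq i r) (hν _)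
    refine ⟨μ, hμ0, hx, hμ0, fun i r => le_add_of_nonneg_right (hν _), ?_, ?_⟩
    · intro i r h
      have h' : 0 < ν (i, r) := by simpa [μ] using h
      have := (mul_eq_zero.1 (hcs (i, r))).resolve_left h'.ne'
      exact (sub_eq_zero.1 this).symm
    · have key : ∀ y, obj1 area nodes U d q y +
          ∑ j : I × R, ν j * (C j.1 j.2 - nodeLoad nodes d y j.1 j.2) =
          (∑ n, payoffNSI area nodes (U n) (d n) μ (y n)) + ∑ j : I × R, ν j * C j.1 j.2 := by
        intro y
        rw [obj1_price_change area nodes U d q μ y, obj1_eq_sum_payoff]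
        simp only [μ, add_sub_cancel_left, mul_sub, Finset.sum_sub_distrib]
        rw [Fintype.sum_prod_type (fun j : I × R => ν j * nodeLoad nodes d y j.1 j.2)]
        ring
      have hle : ∀ y ∈ S, ∑ n, payoffNSI area nodes (U n) (d n) μ (y n) ≤
          ∑ n, payoffNSI area nodes (U n) (d n) μ (x n) := by
        intro y hy
        have h1 := hdual y hy
        have h2 := key x
        rw [key y] at h1
        rw [Finset.sum_eq_zero fun j _ => hcs j] at h2
        linarith
      intro n
      refine ⟨hx.1 n, fun yn hyn => ?_⟩
      have h := hle (Function.update x n yn) (by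
        intro m p
        by_cases hm : m = n
        · subst hm; simpa using hyn p
        · simpa [hm] using hx.1 m p)
      rw [← Finset.add_sum_erase _ _ (Finset.mem_univ n),
        ← Finset.add_sum_erase _ (fun n => payoffNSI area nodes (U n) (d n) μ (x n))
          (Finset.mem_univ n), Function.update_self] at h
      have e : ∑ m ∈ Finset.univ.erase n,
            payoffNSI area nodes (U m) (d m) μ (Function.update x n yn m) =
          ∑ m ∈ Finset.univ.erase n, payoffNSI area nodes (U m) (d m) μ (x m) :=
        Finset.sum_congr rfl fun m hm => by
          rw [Function.update_of_ne (Finset.ne_of_mem_erase hm)]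
      rw [e] at h
      exact le_of_add_le_add_right h
end

section
/- (Remark 1, existence) Assume in addition that for every NSI n and every path p there exist a node i ∈ p and a resource r with d^p_{n,i,r} > 0 (so the feasible set of Problem 1 is compact). Then Problem 1 admits an optimal solution, and consequently there exist a feasible allocation x* and nonnegative prices μ* such that (x*, μ*) is a Nash equilibrium. -/
open Finset

theorem lagrange_aux {E J : Type*} [AddCommGroup E] [Module ℝ E] [Fintype J]
    (S : Set E) (f : E → ℝ) (g : E → J → ℝ) (c : J → ℝ)
    (hf : ConcaveOn ℝ S f)
    (hg : ∀ x y (a b : ℝ) j, g (a • x + b • y) j = a * g x j + b * g y j)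
    (xs x0 : E) (hx0 : x0 ∈ S) (hx0' : ∀ j, g x0 j < c j)
    (hmax : ∀ y ∈ S, (∀ j, g y j ≤ c j) → f y ≤ f xs) :
    ∃ lam : J → ℝ, (∀ j, 0 ≤ lam j) ∧
      ∀ y ∈ S, f y - ∑ j, lam j * (g y j - c j) ≤ f xs := by
  classical
  let K : Set ((J → ℝ) × ℝ) :=
    ⋃ y ∈ S, {p | (∀ j, g y j - c j < p.1 j) ∧ p.2 < f y - f xs}
  have hKmem : ∀ p, p ∈ K ↔ ∃ y ∈ S, (∀ j, g y j - c j < p.1 j) ∧ p.2 < f y - f xs := by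
    intro p; simp only [K, Set.mem_iUnion, exists_prop]; rfl
  have hKo : IsOpen K := by
    refine isOpen_biUnion fun y _ => ?_
    refine IsOpen.and ?_ (isOpen_lt continuous_snd continuous_const)
    simp only [Set.ofPred_forall]
    exact isOpen_iInter_of_finite fun j => isOpen_lt continuous_const (by fun_prop)
  have hKc : Convex ℝ K := by
    intro p hp p' hp' a b ha hb hab
    rw [hKmem] at hp hp' ⊢
    obtain ⟨y, hy, h1, h2⟩ := hp
    obtain ⟨y', hy', h1', h2'⟩ := hp'
    have key : ∀ u v u' v' : ℝ, u < v → u' < v' → a * u + b * u' < a * v + b * v' := by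
      intro u v u' v' h h'
      rcases ha.eq_or_lt with rfl | ha
      · have : b = 1 := by linarith
        subst this; linarith
      · have e1 := mul_lt_mul_of_pos_left h ha
        have e2 := mul_le_mul_of_nonneg_left h'.le hb
        linarith
    refine ⟨a • y + b • y', hf.1 hy hy' ha hb hab, fun j => ?_, ?_⟩
    · have := key _ _ _ _ (h1 j) (h1' j)
      simp only [hg, Prod.fst_add, Prod.smul_fst, Pi.add_apply, Pi.smul_apply, smul_eq_mul]
      have e : c j = a * c j + b * c j := by rw [← add_mul, hab, one_mul]
      linarith
    · have := key _ _ _ _ h2 h2'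
      have h3 := hf.2 hy hy' ha hb hab
      simp only [Prod.snd_add, Prod.smul_snd, smul_eq_mul] at h3 ⊢
      have e : f xs = a * f xs + b * f xs := by rw [← add_mul, hab, one_mul]
      linarith
  have h0 : (0 : (J → ℝ) × ℝ) ∉ K := by
    rw [hKmem]
    rintro ⟨y, hy, h1, h2⟩
    have := hmax y hy fun j => by have := h1 j; simp at this; exact this.le
    simp at h2; linarith
  obtain ⟨φ, hφ⟩ := geometric_hahn_banach_open_point hKc hKo h0
  rw [map_zero] at hφ
  let a : J → ℝ := fun j => φ (Pi.single j 1, 0)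
  let b : ℝ := φ (0, 1)
  have hφe : ∀ u t, φ (u, t) = ∑ j, u j * a j + t * b := by
    intro u t
    have e : (u, t) = ∑ j, u j • ((Pi.single j 1, 0) : (J → ℝ) × ℝ) + t • ((0, 1) : (J → ℝ) × ℝ) := by
      ext k
      · simp [Prod.fst_sum, Finset.sum_apply, Pi.single_apply]
      · simp [Prod.snd_sum]
    rw [e, map_add, map_sum, map_smul]
    simp only [map_smul, smul_eq_mul, a, b]
  -- limit inequality
  have hlim : ∀ y ∈ S, ∀ u : J → ℝ, ∀ t : ℝ, (∀ j, g y j - c j ≤ u j) → t ≤ f y - f xs →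
      ∑ j, u j * a j + t * b ≤ 0 := by
    intro y hy u t hu ht
    have hlt : ∀ ε : ℝ, 0 < ε → (∑ j, u j * a j + t * b) + ε * (∑ j, a j - b) < 0 := by
      intro ε hε
      have := hφ (fun j => u j + ε, t - ε) ((hKmem _).2 ⟨y, hy, fun j => by
        have := hu j; simp; linarith, by simp; linarith⟩)
      rw [hφe] at this
      have e : ∑ j, (u j + ε) * a j = ∑ j, u j * a j + ε * ∑ j, a j := by
        rw [Finset.mul_sum, ← Finset.sum_add_distrib]
        exact Finset.sum_congr rfl fun j _ => by ring
      rw [e] at this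
      linarith
    have ht : Filter.Tendsto (fun ε : ℝ => (∑ j, u j * a j + t * b) + ε * (∑ j, a j - b))
        (nhdsWithin 0 (Set.Ioi 0)) (nhds ((∑ j, u j * a j + t * b) + 0 * (∑ j, a j - b))) :=
      (Continuous.tendsto (by fun_prop) 0).mono_left nhdsWithin_le_nhds
    have := le_of_tendsto ht (b := 0)
      (by filter_upwards [self_mem_nhdsWithin] with ε hε using (hlt ε hε).le)
    simpa using this
  have hb : 0 < b := by
    have := hφ (0, f x0 - f xs - 1 - |f x0 - f xs|) ((hKmem _).2 ⟨x0, hx0, fun j => by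
        have := hx0' j; simp; linarith, by
        have := abs_nonneg (f x0 - f xs); simp only; linarith⟩)
    rw [hφe] at this
    simp only [Pi.zero_apply, zero_mul, Finset.sum_const_zero, zero_add] at this
    have h2 := le_abs_self (f x0 - f xs)
    by_contra hb
    push Not at hb
    nlinarith
  have ha : ∀ j, a j ≤ 0 := by
    intro j
    by_contra hj
    push Not at hj
    let M := ∑ k, (g x0 k - c k) * a k + (f x0 - f xs) * b
    have := hlim x0 hx0 (fun k => (g x0 k - c k) + if k = j then (|M| + 1) / a j else 0)
      (f x0 - f xs) (fun k => by
        have : 0 ≤ (|M| + 1) / a j := by positivity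
        split_ifs <;> linarith) le_rfl
    have e : ∑ k, ((g x0 k - c k) + if k = j then (|M| + 1) / a j else 0) * a k
        = ∑ k, (g x0 k - c k) * a k + (|M| + 1) := by
      simp only [add_mul _ _ (a _), Finset.sum_add_distrib, ite_mul, zero_mul,
        Finset.sum_ite_eq', Finset.mem_univ, if_true]
      rw [div_mul_cancel₀ _ hj.ne']
    rw [e] at this
    have := neg_abs_le M
    simp only [M] at *
    linarith
  refine ⟨fun j => -a j / b, fun j => div_nonneg (by linarith [ha j]) hb.le, fun y hy => ?_⟩
  have h := hlim y hy (fun j => g y j - c j) (f y - f xs) (fun _ => le_rfl) le_rfl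
  have e : ∑ j, -a j / b * (g y j - c j) = -(∑ j, (g y j - c j) * a j) / b := by
    rw [← Finset.sum_neg_distrib, Finset.sum_div]
    exact Finset.sum_congr rfl fun j _ => by ring
  rw [e]
  have : f y - f xs ≤ -(∑ j, (g y j - c j) * a j) / b := by
    rw [le_div_iff₀ hb]; linarith
  linarith

theorem areaVol_comb {A P : Type*} [Fintype P] [DecidableEq A] (area : P → A)
    (x y : P → ℝ) (a b : ℝ) (l : A) :
    areaVol area (a • x + b • y) l = a * areaVol area x l + b * areaVol area y l := by
  simp [areaVol, Finset.sum_add_distrib, Finset.mul_sum]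

theorem areaVol_nonneg {A P : Type*} [Fintype P] [DecidableEq A] (area : P → A)
    (x : P → ℝ) (hx : ∀ p, 0 ≤ x p) (l : A) : 0 ≤ areaVol area x l :=
  Finset.sum_nonneg fun p _ => hx p

theorem nodeLoad_comb {N I R P : Type*} [Fintype N] [Fintype P] [DecidableEq I]
    (nodes : P → Finset I) (d : N → P → I → R → ℝ) (x y : N → P → ℝ) (a b : ℝ)
    (i : I) (r : R) :
    nodeLoad nodes d (a • x + b • y) i r
      = a * nodeLoad nodes d x i r + b * nodeLoad nodes d y i r := by
  simp only [nodeLoad, Finset.mul_sum, ← Finset.sum_add_distrib]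
  refine Finset.sum_congr rfl fun n _ => Finset.sum_congr rfl fun p _ => ?_
  simp; ring

theorem price_load {N I R P : Type*} [Fintype N] [Fintype I] [Fintype R] [Fintype P]
    [DecidableEq I]
    (nodes : P → Finset I) (d : N → P → I → R → ℝ) (m : I → R → ℝ) (x : N → P → ℝ) :
    ∑ i, ∑ r, m i r * nodeLoad nodes d x i r
      = ∑ n, ∑ p, x n p * pathCost nodes (d n) m p := by
  have h1 : ∀ i r, m i r * nodeLoad nodes d x i r
      = ∑ n, ∑ p, if i ∈ nodes p then x n p * (d n p i r * m i r) else 0 := by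
    intro i r
    rw [nodeLoad, Finset.mul_sum]
    refine Finset.sum_congr rfl fun n _ => ?_
    rw [Finset.mul_sum, Finset.sum_filter]
    exact Finset.sum_congr rfl fun p _ => by split_ifs <;> ring
  have h2 : ∀ n p, x n p * pathCost nodes (d n) m p
      = ∑ i, ∑ r, if i ∈ nodes p then x n p * (d n p i r * m i r) else 0 := by
    intro n p
    rw [pathCost, Finset.mul_sum, ← Finset.sum_subset (Finset.subset_univ (nodes p))]
    · refine Finset.sum_congr rfl fun i hi => ?_
      rw [Finset.mul_sum]
      simp [hi]
    · intro i _ hi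
      simp [hi]
  simp only [h1, h2]
  calc _ = ∑ i, ∑ n, ∑ r, ∑ p, (if i ∈ nodes p then x n p * (d n p i r * m i r) else 0) :=
        Finset.sum_congr rfl fun i _ => Finset.sum_comm
    _ = ∑ n, ∑ i, ∑ r, ∑ p, (if i ∈ nodes p then x n p * (d n p i r * m i r) else 0) :=
        Finset.sum_comm
    _ = ∑ n, ∑ i, ∑ p, ∑ r, (if i ∈ nodes p then x n p * (d n p i r * m i r) else 0) :=
        Finset.sum_congr rfl fun n _ => Finset.sum_congr rfl fun i _ => Finset.sum_comm
    _ = _ := Finset.sum_congr rfl fun n _ => Finset.sum_comm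

theorem payoff_eq {A I R P : Type*} [Fintype A] [Fintype P] [Fintype R]
    [DecidableEq A] (area : P → A) (nodes : P → Finset I) (U : A → ℝ → ℝ)
    (d : P → I → R → ℝ) (m : I → R → ℝ) (xn : P → ℝ) :
    payoffNSI area nodes U d m xn
      = (∑ l, U l (areaVol area xn l)) - ∑ p, xn p * pathCost nodes d m p := by
  rw [payoffNSI, Finset.sum_fiberwise]

theorem statement5 {N A I R P : Type*} [Fintype N] [Fintype A] [Fintype I] [Fintype R] [Fintype P]
    [Nonempty N] [Nonempty A] [Nonempty I] [Nonempty R]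
    [DecidableEq A] [DecidableEq I]
    (area : P → A) (nodes : P → Finset I)
    (d : N → P → I → R → ℝ) (C q : I → R → ℝ)
    (U U' : N → A → ℝ → ℝ)
    (hP : ∀ l : A, ∃ p : P, area p = l)
    (hd : ∀ n p i r, 0 ≤ d n p i r)
    (hC : ∀ i r, 0 < C i r)
    (hq : ∀ i r, 0 ≤ q i r)
    (hU : ∀ n l, StrictConcaveOn ℝ (Set.Ici (0 : ℝ)) (U n l))
    (hU' : ∀ n l z, (0 : ℝ) ≤ z → HasDerivWithinAt (U n l) (U' n l z) (Set.Ici 0) z)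
    (hU'c : ∀ n l, ContinuousOn (U' n l) (Set.Ici 0))
    (hdp : ∀ (n : N) (p : P), ∃ i ∈ nodes p, ∃ r : R, 0 < d n p i r) :
    (∃ x : N → P → ℝ, FeasibleAlloc nodes d C x ∧
        ∀ y : N → P → ℝ, FeasibleAlloc nodes d C y →
          obj1 area nodes U d q y ≤ obj1 area nodes U d q x) ∧
      ∃ (xstar : N → P → ℝ) (μstar : I → R → ℝ),
        FeasibleAlloc nodes d C xstar ∧ (∀ i r, 0 ≤ μstar i r) ∧
          IsNE area nodes U d C q xstar μstar := by
  classical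
  have hUc : ∀ n l, ContinuousOn (U n l) (Set.Ici 0) := fun n l z hz =>
    (hU' n l z hz).continuousWithinAt
  have hload_cont : ∀ i r, Continuous fun x : N → P → ℝ => nodeLoad nodes d x i r := by
    intro i r
    unfold nodeLoad
    fun_prop
  have hvol_cont : ∀ n l, Continuous fun x : N → P → ℝ => areaVol area (x n) l := by
    intro n l
    unfold areaVol
    fun_prop
  have hload_zero : ∀ i r, nodeLoad nodes d (0 : N → P → ℝ) i r = 0 := by
    intro i r; simp [nodeLoad]
  let F : Set (N → P → ℝ) := {x | FeasibleAlloc nodes d C x}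
  have hFclosed : IsClosed F := by
    have : F = (⋂ n, ⋂ p, {x | 0 ≤ x n p}) ∩ ⋂ i, ⋂ r, {x | nodeLoad nodes d x i r ≤ C i r} := by
      ext x; simp [F, FeasibleAlloc]
    rw [this]
    refine IsClosed.inter ?_ ?_
    · exact isClosed_iInter fun n => isClosed_iInter fun p =>
        isClosed_le continuous_const (by fun_prop)
    · exact isClosed_iInter fun i => isClosed_iInter fun r =>
        isClosed_le (hload_cont i r) continuous_const
  choose ii hii rr hrr using hdp
  have hFsub : F ⊆ Set.Icc 0 (fun n p => C (ii n p) (rr n p) / d n p (ii n p) (rr n p)) := by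
    rintro x ⟨hx0, hx1⟩
    refine ⟨fun n p => hx0 n p, fun n p => ?_⟩
    show x n p ≤ C (ii n p) (rr n p) / d n p (ii n p) (rr n p)
    rw [le_div_iff₀ (hrr n p)]
    refine le_trans ?_ (hx1 (ii n p) (rr n p))
    unfold nodeLoad
    have e1 := Finset.single_le_sum (s := Finset.univ.filter fun p' => ii n p ∈ nodes p')
      (f := fun p' => x n p' * d n p' (ii n p) (rr n p))
      (fun p' _ => mul_nonneg (hx0 _ _) (hd _ _ _ _)) (a := p) (by simp [hii n p])
    refine le_trans e1 ?_
    exact Finset.single_le_sum (s := Finset.univ)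
      (f := fun n' => ∑ p' ∈ Finset.univ.filter (fun p' => ii n p ∈ nodes p'),
        x n' p' * d n' p' (ii n p) (rr n p))
      (fun n' _ => Finset.sum_nonneg fun p' _ => mul_nonneg (hx0 _ _) (hd _ _ _ _))
      (Finset.mem_univ n)
  have hFcomp : IsCompact F := isCompact_Icc.of_isClosed_subset hFclosed hFsub
  have hF0 : (0 : N → P → ℝ) ∈ F :=
    ⟨fun _ _ => le_rfl, fun i r => by rw [hload_zero]; exact (hC i r).le⟩
  have hobj : ContinuousOn (obj1 area nodes U d q) F := by
    unfold obj1
    refine ContinuousOn.sub ?_ ?_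
    · refine continuousOn_finsetSum _ fun n _ => continuousOn_finsetSum _ fun l _ => ?_
      exact (hUc n l).comp (hvol_cont n l).continuousOn
        fun x hx => areaVol_nonneg area (x n) (hx.1 n) l
    · exact (continuous_finsetSum _ fun i _ => continuous_finsetSum _ fun r _ =>
        continuous_const.mul (hload_cont i r)).continuousOn
  obtain ⟨xs, hxs, hmax⟩ := hFcomp.exists_isMaxOn ⟨0, hF0⟩ hobj
  have hmax' : ∀ y, FeasibleAlloc nodes d C y →
      obj1 area nodes U d q y ≤ obj1 area nodes U d q xs := fun y hy => hmax hy
  refine ⟨⟨xs, hxs, hmax'⟩, ?_⟩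
  let S : Set (N → P → ℝ) := {x | ∀ n p, 0 ≤ x n p}
  have hS : Convex ℝ S := by
    intro x hx y hy a b ha hb _ n p
    exact add_nonneg (mul_nonneg ha (hx n p)) (mul_nonneg hb (hy n p))
  have hconc : ConcaveOn ℝ S (obj1 area nodes U d q) := by
    refine ⟨hS, fun x hx y hy a b ha hb hab => ?_⟩
    have h1 : ∀ n l, a * U n l (areaVol area (x n) l) + b * U n l (areaVol area (y n) l)
        ≤ U n l (areaVol area ((a • x + b • y) n) l) := by
      intro n l
      have := (hU n l).concaveOn.2 (areaVol_nonneg area (x n) (hx n) l)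
        (areaVol_nonneg area (y n) (hy n) l) ha hb hab
      have e : (a • x + b • y) n = a • x n + b • y n := rfl
      rw [e, areaVol_comb]
      exact this
    have h2 := Finset.sum_le_sum fun n (_ : n ∈ Finset.univ) =>
      Finset.sum_le_sum fun l (_ : l ∈ Finset.univ) => h1 n l
    have h3 : ∑ i, ∑ r, q i r * nodeLoad nodes d (a • x + b • y) i r
        = a * ∑ i, ∑ r, q i r * nodeLoad nodes d x i r
          + b * ∑ i, ∑ r, q i r * nodeLoad nodes d y i r := by
      simp only [nodeLoad_comb, Finset.mul_sum, ← Finset.sum_add_distrib]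
      exact Finset.sum_congr rfl fun i _ => Finset.sum_congr rfl fun r _ => by ring
    simp only [Finset.sum_add_distrib, ← Finset.mul_sum] at h2
    simp only [obj1, smul_eq_mul]
    rw [h3]
    linarith
  obtain ⟨lam, hlam, hL⟩ := lagrange_aux (J := I × R) S (obj1 area nodes U d q)
    (fun x j => nodeLoad nodes d x j.1 j.2) (fun j => C j.1 j.2) hconc
    (fun x y a b j => nodeLoad_comb nodes d x y a b j.1 j.2) xs 0 (fun _ _ => le_rfl)
    (fun j => by rw [hload_zero]; exact hC _ _)
    (fun y hy hyc => hmax' y ⟨hy, fun i r => hyc (i, r)⟩)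
  have hterm : ∀ j ∈ (Finset.univ : Finset (I × R)),
      lam j * (nodeLoad nodes d xs j.1 j.2 - C j.1 j.2) ≤ 0 := fun j _ =>
    mul_nonpos_of_nonneg_of_nonpos (hlam j) (by linarith [hxs.2 j.1 j.2])
  have hsum0 : ∑ j, lam j * (nodeLoad nodes d xs j.1 j.2 - C j.1 j.2) = 0 :=
    le_antisymm (Finset.sum_nonpos hterm) (by linarith [hL xs hxs.1])
  have hcs := (Finset.sum_eq_zero_iff_of_nonpos hterm).1 hsum0
  let m : I → R → ℝ := fun i r => q i r + lam (i, r)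
  have hLag : ∀ x, obj1 area nodes U d q x
      - ∑ j, lam j * (nodeLoad nodes d x j.1 j.2 - C j.1 j.2)
      = ∑ n, payoffNSI area nodes (U n) (d n) m (x n) + ∑ j : I × R, lam j * C j.1 j.2 := by
    intro x
    simp only [payoff_eq, Finset.sum_sub_distrib]
    rw [← price_load, obj1]
    simp only [mul_sub, Finset.sum_sub_distrib, m, add_mul, Finset.sum_add_distrib,
      Fintype.sum_prod_type]
    ring
  refine ⟨xs, m, hxs, fun i r => add_nonneg (hq i r) (hlam _), hxs,
    fun i r => add_nonneg (hq i r) (hlam _), fun i r => le_add_of_nonneg_right (hlam _),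
    fun i r h => ?_, fun n => ⟨hxs.1 n, fun y hy => ?_⟩⟩
  · have h1 : lam (i, r) ≠ 0 := by
      intro h0
      simp [m, h0] at h
    have := hcs (i, r) (Finset.mem_univ _)
    rcases mul_eq_zero.1 this with h2 | h2
    · exact absurd h2 h1
    · exact sub_eq_zero.1 h2
  · have h1 := hL (Function.update xs n y) (by
      intro n' p
      by_cases h : n' = n
      · subst h; simpa using hy p
      · simpa [h] using hxs.1 n' p)
    have h2 := hLag xs
    rw [hLag] at h1
    rw [hsum0] at h2
    have e : ∀ x : N → P → ℝ, ∑ n, payoffNSI area nodes (U n) (d n) m (x n)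
        = payoffNSI area nodes (U n) (d n) m (x n)
          + ∑ k ∈ Finset.univ.erase n, payoffNSI area nodes (U k) (d k) m (x k) := fun x =>
      (Finset.add_sum_erase _ (fun k => payoffNSI area nodes (U k) (d k) m (x k))
        (Finset.mem_univ n)).symm
    rw [e] at h1 h2
    have e2 : ∑ k ∈ Finset.univ.erase n,
          payoffNSI area nodes (U k) (d k) m (Function.update xs n y k)
        = ∑ k ∈ Finset.univ.erase n, payoffNSI area nodes (U k) (d k) m (xs k) :=
      Finset.sum_congr rfl fun k hk => by
        rw [Function.update_of_ne (Finset.ne_of_mem_erase hk)]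
    rw [e2, Function.update_self] at h1
    linarith
end

section
/- (Theorem 2) Let (x*, μ*) be a Nash equilibrium and let w*_{n,l} := Σ_{p∈P_l} x*_n^p c^n_p(μ*) be the equilibrium payments, and assume w*_{n,l} > 0 for all n, l. Define Problem 3: maximize Σ_{n,l} w*_{n,l} · log(x_{n,l}) − Σ_{i,r} q_{i,r} Σ_n Σ_{p : i∈p} x_n^p d^p_{n,i,r} over all feasible allocations x with x_{n,l} > 0 for all n, l. Then a feasible allocation x forms a Nash equilibrium (x, μ) together with some nonnegative prices μ if and only if x is an optimal solution of Problem 3. -/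
open Finset

lemma aux_pay_load {N A I R P : Type*} [Fintype N] [Fintype A] [Fintype I] [Fintype R] [Fintype P]
    [DecidableEq A] [DecidableEq I] (area : P → A) (nodes : P → Finset I)
    (d : N → P → I → R → ℝ) (μ : I → R → ℝ) (x : N → P → ℝ) :
    ∑ n, ∑ l, ∑ p ∈ Finset.univ.filter (fun p => area p = l),
      x n p * pathCost nodes (d n) μ p = ∑ i, ∑ r, μ i r * nodeLoad nodes d x i r := by
  have h1 : ∀ n, ∑ l, ∑ p ∈ Finset.univ.filter (fun p => area p = l),
      x n p * pathCost nodes (d n) μ p = ∑ p, x n p * pathCost nodes (d n) μ p := by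
    intro n
    exact Finset.sum_fiberwise _ _ _
  have h2 : ∀ n p, x n p * pathCost nodes (d n) μ p
      = ∑ i, ∑ r, if i ∈ nodes p then μ i r * (x n p * d n p i r) else 0 := by
    intro n p
    unfold pathCost
    rw [Finset.mul_sum, ← Finset.sum_filter_add_sum_filter_not Finset.univ (fun i => i ∈ nodes p)]
    have : ∑ i ∈ Finset.univ.filter (fun i => ¬ i ∈ nodes p),
        (∑ r, if i ∈ nodes p then μ i r * (x n p * d n p i r) else 0) = 0 := by
      apply Finset.sum_eq_zero
      intro i hi
      simp only [Finset.mem_filter] at hi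
      simp [hi.2]
    rw [this, add_zero]
    have hf : Finset.univ.filter (fun i => i ∈ nodes p) = nodes p := by ext; simp
    rw [hf]
    apply Finset.sum_congr rfl
    intro i hi
    rw [Finset.mul_sum]
    apply Finset.sum_congr rfl
    intro r _
    rw [if_pos hi]; ring
  simp_rw [h1, h2]
  unfold nodeLoad
  simp_rw [Finset.mul_sum, Finset.sum_filter]
  calc ∑ n, ∑ p, ∑ i, ∑ r, (if i ∈ nodes p then μ i r * (x n p * d n p i r) else 0)
      = ∑ n, ∑ i, ∑ r, ∑ p, (if i ∈ nodes p then μ i r * (x n p * d n p i r) else 0) := by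
        apply Finset.sum_congr rfl
        intro n _
        rw [Finset.sum_comm]
        apply Finset.sum_congr rfl
        intro i _
        rw [Finset.sum_comm]
    _ = ∑ i, ∑ r, ∑ n, ∑ p, (if i ∈ nodes p then μ i r * (x n p * d n p i r) else 0) := by
        rw [Finset.sum_comm]
        apply Finset.sum_congr rfl
        intro i _
        rw [Finset.sum_comm]

lemma aux_area {A I R P : Type*} [Fintype A] [Fintype P] [Fintype R] [DecidableEq A]
    (area : P → A) (nodes : P → Finset I) (U : A → ℝ → ℝ) (d : P → I → R → ℝ)
    (μ : I → R → ℝ) (x : P → ℝ) (h : MaximizesPayoff area nodes U d μ x)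
    (z : P → ℝ) (hz : ∀ p, 0 ≤ z p) (l : A) :
    U l (areaVol area z l) - ∑ p ∈ Finset.univ.filter (fun p => area p = l),
      z p * pathCost nodes d μ p ≤
    U l (areaVol area x l) - ∑ p ∈ Finset.univ.filter (fun p => area p = l),
      x p * pathCost nodes d μ p := by
  have h2 := h.2 (fun p => if area p = l then z p else x p) (by
    intro p
    split_ifs
    · exact hz p
    · exact h.1 p)
  have e : ∀ y : P → ℝ, payoffNSI area nodes U d μ y = ∑ k, (U k (areaVol area y k) -
      ∑ p ∈ Finset.univ.filter (fun p => area p = k), y p * pathCost nodes d μ p) := by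
    intro y
    rw [Finset.sum_sub_distrib]; rfl
  rw [e, e, ← Finset.add_sum_erase _ _ (Finset.mem_univ l),
    ← Finset.add_sum_erase Finset.univ (fun k => (U k (areaVol area x k) -
      ∑ p ∈ Finset.univ.filter (fun p => area p = k), x p * pathCost nodes d μ p))
      (Finset.mem_univ l)] at h2
  have e1 : areaVol area (fun p => if area p = l then z p else x p) l = areaVol area z l := by
    unfold areaVol
    apply Finset.sum_congr rfl
    intro p hp
    simp only [Finset.mem_filter] at hp
    simp [hp.2]
  have e2 : ∑ p ∈ Finset.univ.filter (fun p => area p = l),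
      (if area p = l then z p else x p) * pathCost nodes d μ p =
      ∑ p ∈ Finset.univ.filter (fun p => area p = l), z p * pathCost nodes d μ p := by
    apply Finset.sum_congr rfl
    intro p hp
    simp only [Finset.mem_filter] at hp
    simp [hp.2]
  have e3 : ∑ k ∈ Finset.univ.erase l,
      (U k (areaVol area (fun p => if area p = l then z p else x p) k) -
      ∑ p ∈ Finset.univ.filter (fun p => area p = k),
        (if area p = l then z p else x p) * pathCost nodes d μ p) =
      ∑ k ∈ Finset.univ.erase l, (U k (areaVol area x k) -
      ∑ p ∈ Finset.univ.filter (fun p => area p = k), x p * pathCost nodes d μ p) := by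
    apply Finset.sum_congr rfl
    intro k hk
    have hk' := Finset.ne_of_mem_erase hk
    congr 1
    · congr 1
      unfold areaVol
      apply Finset.sum_congr rfl
      intro p hp
      simp only [Finset.mem_filter] at hp
      exact if_neg (by rw [hp.2]; exact hk')
    · apply Finset.sum_congr rfl
      intro p hp
      simp only [Finset.mem_filter] at hp
      rw [if_neg (by rw [hp.2]; exact hk')]
  rw [e1, e2, e3] at h2
  linarith

lemma aux_lam {A I R P : Type*} [Fintype A] [Fintype P] [Fintype R] [DecidableEq A]
    (area : P → A) (nodes : P → Finset I) (U : A → ℝ → ℝ) (d : P → I → R → ℝ)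
    (μ : I → R → ℝ) (x : P → ℝ) (h : MaximizesPayoff area nodes U d μ x)
    (l : A) (lam : ℝ) (hv : 0 < areaVol area x l)
    (hD : HasDerivAt (U l) lam (areaVol area x l)) :
    (∑ p ∈ Finset.univ.filter (fun p => area p = l),
      x p * pathCost nodes d μ p = lam * areaVol area x l) ∧
    ∀ p, area p = l → lam ≤ pathCost nodes d μ p := by
  classical
  set v := areaVol area x l with hvdef
  set S := ∑ p ∈ Finset.univ.filter (fun p => area p = l), x p * pathCost nodes d μ p with hS
  constructor
  · have hmax : IsLocalMax (fun t : ℝ => U l (t * v) - t * S) 1 := by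
      filter_upwards [lt_mem_nhds (zero_lt_one (α := ℝ))] with t ht
      have := aux_area area nodes U d μ x h (fun p => t * x p)
        (fun p => mul_nonneg ht.le (h.1 p)) l
      have e1 : areaVol area (fun p => t * x p) l = t * v := by
        rw [hvdef]; unfold areaVol; rw [Finset.mul_sum]
      have e2 : ∑ p ∈ Finset.univ.filter (fun p => area p = l),
          t * x p * pathCost nodes d μ p = t * S := by
        rw [hS, Finset.mul_sum]
        exact Finset.sum_congr rfl (fun _ _ => by ring)
      rw [e1, e2] at this
      simpa using this
    have hD' : HasDerivAt (fun t : ℝ => U l (t * v) - t * S) (lam * (1 * v) - 1 * S) 1 := by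
      have a : HasDerivAt (fun t : ℝ => t * v) (1 * v) 1 := (hasDerivAt_id 1).mul_const v
      have b : HasDerivAt (fun t : ℝ => t * S) (1 * S) 1 := (hasDerivAt_id 1).mul_const S
      have c : HasDerivAt (U l) lam ((fun t : ℝ => t * v) 1) := by simpa using hD
      exact (c.comp 1 a).sub b
    have := hmax.hasDerivAt_eq_zero hD'
    linarith
  · intro p hp
    set c := pathCost nodes d μ p with hc
    by_contra hlt
    push Not at hlt
    have hD' : HasDerivAt (fun t : ℝ => U l (v + t) - t * c) (lam - 1 * c) 0 := by
      have b : HasDerivAt (fun t : ℝ => t * c) (1 * c) 0 := (hasDerivAt_id 0).mul_const c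
      have a : HasDerivAt (fun t : ℝ => U l (v + t)) lam 0 := by
        apply HasDerivAt.comp_const_add
        simpa using hD
      exact a.sub b
    have hmax : ∀ t : ℝ, 0 ≤ t → U l (v + t) - t * c ≤ U l v := by
      intro t ht
      have := aux_area area nodes U d μ x h (fun k => x k + if k = p then t else 0)
        (fun k => add_nonneg (h.1 k) (by split_ifs <;> simp [ht])) l
      have e1 : areaVol area (fun k => x k + if k = p then t else 0) l = v + t := by
        rw [hvdef]; unfold areaVol; rw [Finset.sum_add_distrib]
        simp [hp]
      have e2 : ∑ k ∈ Finset.univ.filter (fun p => area p = l),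
          (x k + if k = p then t else 0) * pathCost nodes d μ k = S + t * c := by
        simp_rw [add_mul]
        rw [Finset.sum_add_distrib]
        simp [hp, hS, hc]
      rw [e1, e2] at this
      linarith
    have hpos : 0 < lam - 1 * c := by linarith
    have hev := (hasDerivAt_iff_tendsto_slope_zero.1 hD').eventually (lt_mem_nhds hpos)
    have hev2 : ∀ᶠ t in nhdsWithin (0:ℝ) (Set.Ioi 0), 0 < t⁻¹ •
        ((U l (v + (0 + t)) - (0 + t) * c) - (U l (v + 0) - 0 * c)) :=
      hev.filter_mono (nhdsWithin_mono _ (fun t ht => ne_of_gt ht))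
    obtain ⟨t, ht, ht0⟩ := (hev2.and self_mem_nhdsWithin).exists
    have ht0' : 0 < t := ht0
    have := hmax t ht0'.le
    rw [smul_eq_mul] at ht
    have h3 := (pos_iff_pos_of_mul_pos ht).1 (inv_pos.2 ht0')
    simp only [zero_add, add_zero, zero_mul, sub_zero] at h3
    linarith

lemma aux_log {w vx vy lam : ℝ} (hx : 0 < vx) (hy : 0 < vy) (hw : 0 < w) (h : w = lam * vx) :
    0 ≤ w * (Real.log vx - Real.log vy) + lam * (vy - vx) ∧
    (w * (Real.log vx - Real.log vy) + lam * (vy - vx) = 0 → vy = vx) := by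
  have hlam : lam = w / vx := by field_simp; linarith
  have e : w * (Real.log vx - Real.log vy) + lam * (vy - vx)
      = w * (vy / vx - 1 - Real.log (vy / vx)) := by
    rw [Real.log_div hy.ne' hx.ne', hlam]; field_simp; ring
  rw [e]
  have hr : 0 < vy / vx := div_pos hy hx
  refine ⟨mul_nonneg hw.le (by linarith [Real.log_le_sub_one_of_pos hr]), fun h0 => ?_⟩
  by_contra hne
  have hne' : vy / vx ≠ 1 := by
    intro h1; exact hne ((div_eq_one_iff_eq hx.ne').1 h1)
  have := Real.log_lt_sub_one_of_pos hr hne'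
  have : 0 < w * (vy / vx - 1 - Real.log (vy / vx)) := mul_pos hw (by linarith)
  linarith

lemma aux_core {N A I R P : Type*} [Fintype N] [Fintype A] [Fintype I] [Fintype R] [Fintype P]
    [DecidableEq A] [DecidableEq I] (area : P → A) (nodes : P → Finset I)
    (d : N → P → I → R → ℝ) (q μ : I → R → ℝ) (w lam : N → A → ℝ) (x y : N → P → ℝ)
    (hl : ∀ n l, ∑ p ∈ Finset.univ.filter (fun p => area p = l),
      x n p * pathCost nodes (d n) μ p = lam n l * areaVol area (x n) l) :
    obj3 area nodes d q w x - obj3 area nodes d q w y =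
      (∑ n, ∑ l, (w n l * (Real.log (areaVol area (x n) l) - Real.log (areaVol area (y n) l))
        + lam n l * (areaVol area (y n) l - areaVol area (x n) l))) +
      (∑ n, ∑ l, (∑ p ∈ Finset.univ.filter (fun p => area p = l),
        y n p * pathCost nodes (d n) μ p - lam n l * areaVol area (y n) l)) +
      ∑ i, ∑ r, (μ i r - q i r) * (nodeLoad nodes d x i r - nodeLoad nodes d y i r) := by
  have hx := aux_pay_load area nodes d μ x
  have hy := aux_pay_load area nodes d μ y
  simp_rw [hl] at hx
  unfold obj3
  simp only [mul_sub, sub_mul, Finset.sum_sub_distrib, Finset.sum_add_distrib]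
  rw [hy, hx]
  ring

lemma aux_mid_load {N I R P : Type*} [Fintype N] [Fintype P] [DecidableEq I]
    (nodes : P → Finset I) (d : N → P → I → R → ℝ) (x y : N → P → ℝ) (i : I) (r : R) :
    nodeLoad nodes d (fun n p => (1/2 : ℝ) * x n p + (1/2 : ℝ) * y n p) i r =
      (1/2 : ℝ) * nodeLoad nodes d x i r + (1/2 : ℝ) * nodeLoad nodes d y i r := by
  unfold nodeLoad
  simp only [Finset.mul_sum, ← Finset.sum_add_distrib]
  exact Finset.sum_congr rfl fun _ _ => Finset.sum_congr rfl fun _ _ => by ring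

/-- A Nash equilibrium is optimal for Problem 1. -/
lemma aux_opt1 {N A I R P : Type*} [Fintype N] [Fintype A] [Fintype I] [Fintype R] [Fintype P]
    [DecidableEq A] [DecidableEq I] (area : P → A) (nodes : P → Finset I)
    (d : N → P → I → R → ℝ) (C q : I → R → ℝ) (U : N → A → ℝ → ℝ)
    (x : N → P → ℝ) (μ : I → R → ℝ) (h : IsNE area nodes U d C q x μ)
    (y : N → P → ℝ) (hy : FeasibleAlloc nodes d C y) :
    obj1 area nodes U d q y ≤ obj1 area nodes U d q x := by
  obtain ⟨hf, h0, h1, h2, h3⟩ := h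
  have hs : ∑ n, payoffNSI area nodes (U n) (d n) μ (y n) ≤
      ∑ n, payoffNSI area nodes (U n) (d n) μ (x n) :=
    Finset.sum_le_sum fun n _ => (h3 n).2 (y n) (hy.1 n)
  unfold payoffNSI at hs
  rw [Finset.sum_sub_distrib, Finset.sum_sub_distrib, aux_pay_load, aux_pay_load] at hs
  have hg : 0 ≤ ∑ i, ∑ r, (μ i r - q i r) * (nodeLoad nodes d x i r - nodeLoad nodes d y i r) := by
    refine Finset.sum_nonneg fun i _ => Finset.sum_nonneg fun r _ => ?_
    rcases (h1 i r).eq_or_lt with e | e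
    · rw [e]; simp
    · rw [h2 i r e]; exact mul_nonneg (by linarith) (by linarith [hy.2 i r])
  simp only [mul_sub, sub_mul, Finset.sum_sub_distrib] at hg
  unfold obj1
  linarith

/-- Area volumes are unique among Nash equilibria. -/
lemma aux_uniq {N A I R P : Type*} [Fintype N] [Fintype A] [Fintype I] [Fintype R] [Fintype P]
    [DecidableEq A] [DecidableEq I] (area : P → A) (nodes : P → Finset I)
    (d : N → P → I → R → ℝ) (C q : I → R → ℝ) (U : N → A → ℝ → ℝ)
    (hU : ∀ n l, StrictConcaveOn ℝ (Set.Ici (0 : ℝ)) (U n l))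
    (x y : N → P → ℝ) (μ ν : I → R → ℝ) (hx : IsNE area nodes U d C q x μ)
    (hy : IsNE area nodes U d C q y ν) (n : N) (l : A) :
    areaVol area (x n) l = areaVol area (y n) l := by
  by_contra hne
  have hvx : ∀ n l, 0 ≤ areaVol area (x n) l := fun n l =>
    Finset.sum_nonneg fun p _ => hx.1.1 n p
  have hvy : ∀ n l, 0 ≤ areaVol area (y n) l := fun n l =>
    Finset.sum_nonneg fun p _ => hy.1.1 n p
  set z : N → P → ℝ := fun n p => (1/2 : ℝ) * x n p + (1/2 : ℝ) * y n p with hz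
  have hzf : FeasibleAlloc nodes d C z := by
    refine ⟨fun n p => ?_, fun i r => ?_⟩
    · have := hx.1.1 n p
      have := hy.1.1 n p
      simp only [hz]; positivity
    · rw [hz, aux_mid_load]
      linarith [hx.1.2 i r, hy.1.2 i r]
  have h1 := aux_opt1 area nodes d C q U x μ hx z hzf
  have h2 := aux_opt1 area nodes d C q U y ν hy z hzf
  have hvz : ∀ n l, areaVol area (z n) l =
      (1/2 : ℝ) * areaVol area (x n) l + (1/2 : ℝ) * areaVol area (y n) l := by
    intro n l
    unfold areaVol
    rw [Finset.mul_sum, Finset.mul_sum, ← Finset.sum_add_distrib]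
  have hle : ∀ n l, (1/2 : ℝ) * U n l (areaVol area (x n) l) +
      (1/2 : ℝ) * U n l (areaVol area (y n) l) ≤ U n l (areaVol area (z n) l) := by
    intro n l
    rw [hvz]
    have := (hU n l).concaveOn.2 (Set.mem_Ici.2 (hvx n l)) (Set.mem_Ici.2 (hvy n l))
      (show (0:ℝ) ≤ 1/2 by norm_num) (show (0:ℝ) ≤ 1/2 by norm_num) (by norm_num)
    simpa only [smul_eq_mul] using this
  have hlt : (1/2 : ℝ) * U n l (areaVol area (x n) l) +
      (1/2 : ℝ) * U n l (areaVol area (y n) l) < U n l (areaVol area (z n) l) := by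
    rw [hvz]
    have := (hU n l).2 (Set.mem_Ici.2 (hvx n l)) (Set.mem_Ici.2 (hvy n l)) hne
      (show (0:ℝ) < 1/2 by norm_num) (show (0:ℝ) < 1/2 by norm_num) (by norm_num)
    simpa only [smul_eq_mul] using this
  have hsum : ∑ n, ∑ l, ((1/2 : ℝ) * U n l (areaVol area (x n) l) +
      (1/2 : ℝ) * U n l (areaVol area (y n) l)) < ∑ n, ∑ l, U n l (areaVol area (z n) l) :=
    Finset.sum_lt_sum (fun n _ => Finset.sum_le_sum fun l _ => hle n l)
      ⟨n, Finset.mem_univ n, Finset.sum_lt_sum (fun l _ => hle n l) ⟨l, Finset.mem_univ l, hlt⟩⟩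
  have hld : ∑ i, ∑ r, q i r * nodeLoad nodes d z i r =
      (1/2 : ℝ) * ∑ i, ∑ r, q i r * nodeLoad nodes d x i r +
      (1/2 : ℝ) * ∑ i, ∑ r, q i r * nodeLoad nodes d y i r := by
    simp only [hz, aux_mid_load, Finset.mul_sum, ← Finset.sum_add_distrib]
    exact Finset.sum_congr rfl fun _ _ => Finset.sum_congr rfl fun _ _ => by ring
  simp only [Finset.sum_add_distrib, ← Finset.mul_sum] at hsum
  unfold obj1 at h1 h2
  rw [hld] at h1 h2
  linarith

lemma aux_zero2 {α β : Type*} [Fintype α] [Fintype β] (f : α → β → ℝ)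
    (hf : ∀ a b, 0 ≤ f a b) (hs : ∑ a, ∑ b, f a b ≤ 0) (a : α) (b : β) : f a b = 0 := by
  have h1 := (Finset.sum_eq_zero_iff_of_nonneg
    (fun a _ => Finset.sum_nonneg fun b _ => hf a b)).1
    (le_antisymm hs (Finset.sum_nonneg fun a _ => Finset.sum_nonneg fun b _ => hf a b))
    a (Finset.mem_univ a)
  exact (Finset.sum_eq_zero_iff_of_nonneg (fun b _ => hf a b)).1 h1 b (Finset.mem_univ b)

theorem statement8 {N A I R P : Type*} [Fintype N] [Fintype A] [Fintype I] [Fintype R] [Fintype P]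
    [Nonempty N] [Nonempty A] [Nonempty I] [Nonempty R]
    [DecidableEq A] [DecidableEq I]
    (area : P → A) (nodes : P → Finset I)
    (d : N → P → I → R → ℝ) (C q : I → R → ℝ)
    (U U' : N → A → ℝ → ℝ)
    (hP : ∀ l : A, ∃ p : P, area p = l)
    (hd : ∀ n p i r, 0 ≤ d n p i r)
    (hC : ∀ i r, 0 < C i r)
    (hq : ∀ i r, 0 ≤ q i r)
    (hU : ∀ n l, StrictConcaveOn ℝ (Set.Ici (0 : ℝ)) (U n l))
    (hU' : ∀ n l z, (0 : ℝ) ≤ z → HasDerivWithinAt (U n l) (U' n l z) (Set.Ici 0) z)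
    (hU'c : ∀ n l, ContinuousOn (U' n l) (Set.Ici 0))
    (xstar : N → P → ℝ) (μstar : I → R → ℝ)
    (hNE : IsNE area nodes U d C q xstar μstar)
    (w : N → A → ℝ)
    (hwdef : ∀ n l, w n l =
      ∑ p ∈ Finset.univ.filter (fun p => area p = l),
        xstar n p * pathCost nodes (d n) μstar p)
    (hwpos : ∀ n l, 0 < w n l)
    (x : N → P → ℝ) (hx : FeasibleAlloc nodes d C x) :
    (∃ μ : I → R → ℝ, (∀ i r, 0 ≤ μ i r) ∧ IsNE area nodes U d C q x μ) ↔
      ((∀ (n : N) (l : A), 0 < areaVol area (x n) l) ∧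
        ∀ y : N → P → ℝ, FeasibleAlloc nodes d C y →
          (∀ (n : N) (l : A), 0 < areaVol area (y n) l) →
          obj3 area nodes d q w y ≤ obj3 area nodes d q w x) := by
  have hvs : ∀ n l, 0 < areaVol area (xstar n) l := by
    intro n l
    have h0 : 0 ≤ areaVol area (xstar n) l := Finset.sum_nonneg fun p _ => hNE.1.1 n p
    rcases h0.eq_or_lt with e | e
    · exfalso
      have hz := (Finset.sum_eq_zero_iff_of_nonneg (fun p _ => hNE.1.1 n p)).1 e.symm
      have := hwpos n l
      rw [hwdef, Finset.sum_eq_zero (fun p hp => by rw [hz p hp, zero_mul])] at this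
      exact lt_irrefl _ this
    · exact e
  have hD : ∀ n l, HasDerivAt (U n l) (U' n l (areaVol area (xstar n) l))
      (areaVol area (xstar n) l) := fun n l =>
    (hU' n l _ (hvs n l).le).hasDerivAt (Ici_mem_nhds (hvs n l))
  set lam : N → A → ℝ := fun n l => U' n l (areaVol area (xstar n) l) with hlam
  have hls := fun n l => aux_lam area nodes (U n) (d n) μstar (xstar n) (hNE.2.2.2.2 n) l
    (lam n l) (hvs n l) (hD n l)
  have hw : ∀ n l, w n l = lam n l * areaVol area (xstar n) l := fun n l => by
    rw [hwdef, (hls n l).1]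
  have g2 : ∀ (μ : I → R → ℝ) (y : N → P → ℝ), (∀ n p, 0 ≤ y n p) →
      (∀ n l p, area p = l → lam n l ≤ pathCost nodes (d n) μ p) → ∀ n l,
      0 ≤ ∑ p ∈ Finset.univ.filter (fun p => area p = l),
        y n p * pathCost nodes (d n) μ p - lam n l * areaVol area (y n) l := by
    intro μ y hy hc n l
    unfold areaVol
    rw [Finset.mul_sum, ← Finset.sum_sub_distrib]
    refine Finset.sum_nonneg fun p hp => ?_
    have := mul_nonneg (hy n p) (sub_nonneg.2 (hc n l p (Finset.mem_filter.1 hp).2))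
    linarith
  have g3 : ∀ (μ : I → R → ℝ) (x y : N → P → ℝ), IsNE area nodes U d C q x μ →
      FeasibleAlloc nodes d C y → ∀ i r,
      0 ≤ (μ i r - q i r) * (nodeLoad nodes d x i r - nodeLoad nodes d y i r) := by
    intro μ x y h hy i r
    rcases (h.2.2.1 i r).eq_or_lt with e | e
    · rw [e]; simp
    · rw [h.2.2.2.1 i r e]; exact mul_nonneg (by linarith) (by linarith [hy.2 i r])
  have main : ∀ (x : N → P → ℝ) (μ : I → R → ℝ), IsNE area nodes U d C q x μ →
      (∀ (n : N) (l : A), 0 < areaVol area (x n) l) ∧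
        ∀ y : N → P → ℝ, FeasibleAlloc nodes d C y →
          (∀ (n : N) (l : A), 0 < areaVol area (y n) l) →
          obj3 area nodes d q w y ≤ obj3 area nodes d q w x := by
    intro x μ h
    have hv := aux_uniq area nodes d C q U hU x xstar μ μstar h hNE
    have hvp : ∀ n l, 0 < areaVol area (x n) l := fun n l => by rw [hv]; exact hvs n l
    refine ⟨hvp, fun y hy hyp => ?_⟩
    have hl := fun n l => aux_lam area nodes (U n) (d n) μ (x n) (h.2.2.2.2 n) l
      (lam n l) (hvp n l) (by rw [hv]; exact hD n l)
    have hcore := aux_core area nodes d q μ w lam x y (fun n l => (hl n l).1)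
    have s1 := Finset.sum_nonneg (s := Finset.univ) fun n _ => Finset.sum_nonneg
      (s := Finset.univ) fun l _ => (aux_log (hvp n l) (hyp n l) (hwpos n l)
        (by rw [hv]; exact hw n l)).1
    have s2 := Finset.sum_nonneg (s := Finset.univ) fun n _ => Finset.sum_nonneg
      (s := Finset.univ) fun l _ => g2 μ y hy.1 (fun n l => (hl n l).2) n l
    have s3 := Finset.sum_nonneg (s := Finset.univ) fun i _ => Finset.sum_nonneg
      (s := Finset.univ) fun r _ => g3 μ x y h hy i r
    linarith
  constructor
  · rintro ⟨μ, _, h⟩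
    exact main x μ h
  · rintro ⟨hxp, hopt⟩
    refine ⟨μstar, hNE.2.1, hx, hNE.2.1, hNE.2.2.1, ?_⟩
    have hle := hopt xstar hNE.1 hvs
    have hcore := aux_core area nodes d q μstar w lam xstar x (fun n l => (hls n l).1)
    have t1 := fun n l => aux_log (hvs n l) (hxp n l) (hwpos n l) (hw n l)
    have t2 := g2 μstar x hx.1 (fun n l => (hls n l).2)
    have t3 := g3 μstar xstar x hNE hx
    have s1 := Finset.sum_nonneg (s := Finset.univ) fun n _ => Finset.sum_nonneg
      (s := Finset.univ) fun l _ => (t1 n l).1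
    have s2 := Finset.sum_nonneg (s := Finset.univ) fun n _ => Finset.sum_nonneg
      (s := Finset.univ) fun l _ => t2 n l
    have s3 := Finset.sum_nonneg (s := Finset.univ) fun i _ => Finset.sum_nonneg
      (s := Finset.univ) fun r _ => t3 i r
    have z1 := aux_zero2 _ (fun n l => (t1 n l).1) (by linarith)
    have z2 := aux_zero2 _ t2 (by linarith)
    have z3 := aux_zero2 _ t3 (by linarith)
    have hv : ∀ n l, areaVol area (x n) l = areaVol area (xstar n) l :=
      fun n l => (t1 n l).2 (z1 n l)
    constructor
    · intro i r hlt
      have hb := hNE.2.2.2.1 i r hlt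
      rcases mul_eq_zero.1 (z3 i r) with e | e
      · linarith
      · linarith
    · intro n
      refine ⟨hx.1 n, fun y hy => ((hNE.2.2.2.2 n).2 y hy).trans (le_of_eq ?_)⟩
      unfold payoffNSI
      congr 1
      · exact Finset.sum_congr rfl fun l _ => by rw [hv]
      · refine Finset.sum_congr rfl fun l _ => ?_
        have := z2 n l
        rw [(hls n l).1, ← hv]
        linarith
end

section
/- (Payment identity) Fix an NSI n and nonnegative resource prices μ, and suppose x_n maximizes the payoff Π_n(·; μ) over the nonnegative orthant. Define the area-l payment w_{n,l} := Σ_{p'∈P_l} x_n^{p'} c^n_{p'}(μ). Then for every area l and every path p ∈ P_l with x_n^p > 0, w_{n,l} = x_{n,l} · c^n_p(μ); in particular all paths used by NSI n in area l have the same per-unit cost, equal to w_{n,l}/x_{n,l}. -/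
open Finset

theorem cost_le_of_used {A I R P : Type*} [Fintype A] [Fintype P] [Fintype R] [DecidableEq A]
    (area : P → A) (nodes : P → Finset I) (U : A → ℝ → ℝ) (d : P → I → R → ℝ)
    (μ : I → R → ℝ) (xn : P → ℝ) (hmax : MaximizesPayoff area nodes U d μ xn)
    (p p' : P) (hpp : area p = area p') (hx : 0 < xn p) :
    pathCost nodes d μ p ≤ pathCost nodes d μ p' := by
  classical
  obtain ⟨h0, h⟩ := hmax
  have hy := h (fun k => xn k + (if k = p' then xn p else 0) - (if k = p then xn p else 0)) (by
    intro k
    have hk := h0 k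
    have hp := h0 p
    by_cases h1 : k = p
    · subst h1
      simp only [if_true]
      split_ifs <;> linarith
    · simp only [h1, if_false]
      split_ifs <;> linarith)
  have hv : ∀ l, areaVol area
      (fun k => xn k + (if k = p' then xn p else 0) - (if k = p then xn p else 0)) l
        = areaVol area xn l := by
    intro l
    unfold areaVol
    rw [Finset.sum_sub_distrib, Finset.sum_add_distrib, Finset.sum_ite_eq', Finset.sum_ite_eq']
    simp [hpp]
  unfold payoffNSI at hy
  simp only [hv] at hy
  rw [Finset.sum_fiberwise, Finset.sum_fiberwise] at hy
  simp only [sub_mul, add_mul, ite_mul, zero_mul, Finset.sum_sub_distrib, Finset.sum_add_distrib,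
    Finset.sum_ite_eq', Finset.mem_univ, if_true] at hy
  exact le_of_mul_le_mul_left (by linarith) hx

theorem statement10 {N A I R P : Type*} [Fintype N] [Fintype A] [Fintype I] [Fintype R] [Fintype P]
    [Nonempty N] [Nonempty A] [Nonempty I] [Nonempty R]
    [DecidableEq A] [DecidableEq I]
    (area : P → A) (nodes : P → Finset I)
    (d : N → P → I → R → ℝ) (C q : I → R → ℝ)
    (U U' : N → A → ℝ → ℝ)
    (hP : ∀ l : A, ∃ p : P, area p = l)
    (hd : ∀ n p i r, 0 ≤ d n p i r)
    (hC : ∀ i r, 0 < C i r)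
    (hq : ∀ i r, 0 ≤ q i r)
    (hU : ∀ n l, StrictConcaveOn ℝ (Set.Ici (0 : ℝ)) (U n l))
    (hU' : ∀ n l z, (0 : ℝ) ≤ z → HasDerivWithinAt (U n l) (U' n l z) (Set.Ici 0) z)
    (hU'c : ∀ n l, ContinuousOn (U' n l) (Set.Ici 0))
    (n : N) (μ : I → R → ℝ) (hμ : ∀ i r, 0 ≤ μ i r)
    (xn : P → ℝ) (hmax : MaximizesPayoff area nodes (U n) (d n) μ xn) :
    ∀ (l : A) (p : P), area p = l → 0 < xn p →
      (∑ p' ∈ Finset.univ.filter (fun p' => area p' = l),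
          xn p' * pathCost nodes (d n) μ p') =
        areaVol area xn l * pathCost nodes (d n) μ p := by
  intro l p hp hx
  unfold areaVol
  rw [Finset.sum_mul]
  refine Finset.sum_congr rfl fun p' hp' => ?_
  have hl : area p' = l := (Finset.mem_filter.mp hp').2
  rcases (hmax.1 p').eq_or_lt with h | h
  · rw [← h]; simp
  · rw [le_antisymm
      (cost_le_of_used area nodes (U n) (d n) μ xn hmax p' p (hl.trans hp.symm) h)
      (cost_le_of_used area nodes (U n) (d n) μ xn hmax p p' (hp.trans hl.symm) hx)]
end

section
/- (Envy-freeness, per-path form) Let (x, μ) be a Nash equilibrium and define payments w_{n,l} := Σ_{p∈P_l} x_n^p c^n_p(μ). Then for any two NSIs n, m, any area l with w_{n,l} > 0 and w_{m,l} > 0, and any path p ∈ P_l with x_m^p > 0, it is not the case that (x_{n,l}/w_{n,l}) · d^p_{n,i,r} < (x_{m,l}/w_{m,l}) · d^p_{m,i,r} for every node i ∈ p and every resource r. -/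
open Finset

/-- At a payoff maximizer, a used path is a cheapest path of its area. -/
lemma used_path_cheapest {A I R P : Type*} [Fintype A] [Fintype P] [Fintype R] [DecidableEq A]
    (area : P → A) (nodes : P → Finset I) (U : A → ℝ → ℝ) (d : P → I → R → ℝ)
    (μ : I → R → ℝ) (xn : P → ℝ) (h : MaximizesPayoff area nodes U d μ xn)
    (a b : P) (hab : area a = area b) (ha : 0 < xn a) :
    pathCost nodes d μ a ≤ pathCost nodes d μ b := by
  classical
  obtain ⟨h0, h1⟩ := h
  have h2 := h1 (fun s => xn s + ((if s = b then xn a else 0) - (if s = a then xn a else 0)))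
    (by
      intro s
      have hs := h0 s
      by_cases hb : s = b
      · by_cases hsa : s = a
        · simp only [hb, hsa, if_true]; subst hsa; subst hb; simp; exact hs
        · simp only [hb, if_true]; subst hb; simp only [hsa, if_false]; linarith
      · by_cases hsa : s = a
        · subst hsa; simp [hb]
        · simp [hb, hsa]; exact hs)
  have hv : ∀ l, areaVol area
      (fun s => xn s + ((if s = b then xn a else 0) - (if s = a then xn a else 0))) l
      = areaVol area xn l := by
    intro l
    unfold areaVol
    rw [Finset.sum_add_distrib, Finset.sum_sub_distrib, Finset.sum_ite_eq', Finset.sum_ite_eq']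
    simp [hab]
  unfold payoffNSI at h2
  simp only [hv, Finset.sum_fiberwise] at h2
  simp only [add_mul, sub_mul, ite_mul, zero_mul, Finset.sum_add_distrib,
    Finset.sum_sub_distrib, Finset.sum_ite_eq', Finset.mem_univ, if_true] at h2
  have h3 : xn a * pathCost nodes d μ a ≤ xn a * pathCost nodes d μ b := by linarith
  exact le_of_mul_le_mul_left h3 ha

theorem statement11 {N A I R P : Type*} [Fintype N] [Fintype A] [Fintype I] [Fintype R] [Fintype P]
    [Nonempty N] [Nonempty A] [Nonempty I] [Nonempty R]
    [DecidableEq A] [DecidableEq I]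
    (area : P → A) (nodes : P → Finset I)
    (d : N → P → I → R → ℝ) (C q : I → R → ℝ)
    (U U' : N → A → ℝ → ℝ)
    (hP : ∀ l : A, ∃ p : P, area p = l)
    (hd : ∀ n p i r, 0 ≤ d n p i r)
    (hC : ∀ i r, 0 < C i r)
    (hq : ∀ i r, 0 ≤ q i r)
    (hU : ∀ n l, StrictConcaveOn ℝ (Set.Ici (0 : ℝ)) (U n l))
    (hU' : ∀ n l z, (0 : ℝ) ≤ z → HasDerivWithinAt (U n l) (U' n l z) (Set.Ici 0) z)
    (hU'c : ∀ n l, ContinuousOn (U' n l) (Set.Ici 0))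
    (x : N → P → ℝ) (μ : I → R → ℝ) (hNE : IsNE area nodes U d C q x μ)
    (w : N → A → ℝ)
    (hwdef : ∀ n l, w n l =
      ∑ p ∈ Finset.univ.filter (fun p => area p = l),
        x n p * pathCost nodes (d n) μ p)
    (n m : N) (l : A) (hwn : 0 < w n l) (hwm : 0 < w m l)
    (p : P) (hp : area p = l) (hxm : 0 < x m p) :
    ¬ ∀ i ∈ nodes p, ∀ r : R,
        areaVol area (x n) l / w n l * d n p i r <
          areaVol area (x m) l / w m l * d m p i r := by
  intro H
  obtain ⟨⟨hx0, -⟩, hμ, -, -, hmax⟩ := hNE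
  have hle : ∀ k : N, w k l ≤ areaVol area (x k) l * pathCost nodes (d k) μ p := by
    intro k
    rw [hwdef, areaVol, Finset.sum_mul]
    refine Finset.sum_le_sum fun s hs => ?_
    have hs' : area s = l := (Finset.mem_filter.1 hs).2
    rcases (hx0 k s).eq_or_lt with h | h
    · simp [← h]
    · exact mul_le_mul_of_nonneg_left
        (used_path_cheapest area nodes (U k) (d k) μ (x k) (hmax k) s p (hs'.trans hp.symm) h) h.le
  have hge : areaVol area (x m) l * pathCost nodes (d m) μ p ≤ w m l := by
    rw [hwdef, areaVol, Finset.sum_mul]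
    refine Finset.sum_le_sum fun s hs => ?_
    have hs' : area s = l := (Finset.mem_filter.1 hs).2
    exact mul_le_mul_of_nonneg_left
        (used_path_cheapest area nodes (U m) (d m) μ (x m) (hmax m) p s (hp.trans hs'.symm) hxm)
        (hx0 m s)
  have e : ∀ k : N, areaVol area (x k) l / w k l * pathCost nodes (d k) μ p =
      ∑ i ∈ nodes p, ∑ r, (areaVol area (x k) l / w k l * d k p i r) * μ i r := by
    intro k
    simp only [pathCost, Finset.mul_sum, mul_assoc]
  have hn1 : 1 ≤ areaVol area (x n) l / w n l * pathCost nodes (d n) μ p := by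
    rw [div_mul_eq_mul_div, le_div_iff₀ hwn]; linarith [hle n]
  have hm1 : areaVol area (x m) l / w m l * pathCost nodes (d m) μ p ≤ 1 := by
    rw [div_mul_eq_mul_div, div_le_iff₀ hwm]; linarith
  have hpos : ∃ i ∈ nodes p, ∃ r, 0 < μ i r := by
    by_contra hcon
    push Not at hcon
    have hz : pathCost nodes (d m) μ p = 0 := by
      unfold pathCost
      refine Finset.sum_eq_zero fun i hi => Finset.sum_eq_zero fun r _ => ?_
      rw [le_antisymm (hcon i hi r) (hμ i r), mul_zero]
    have := hle m
    rw [hz, mul_zero] at this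
    linarith
  obtain ⟨i, hi, r, hr⟩ := hpos
  have hlt : areaVol area (x n) l / w n l * pathCost nodes (d n) μ p <
      areaVol area (x m) l / w m l * pathCost nodes (d m) μ p := by
    rw [e, e]
    refine Finset.sum_lt_sum (fun j hj => Finset.sum_le_sum fun s _ =>
      mul_le_mul_of_nonneg_right (H j hj s).le (hμ j s)) ⟨i, hi, ?_⟩
    exact Finset.sum_lt_sum (fun s _ => mul_le_mul_of_nonneg_right (H i hi s).le (hμ i s))
      ⟨r, Finset.mem_univ r, mul_lt_mul_of_pos_right (H i hi r) hr⟩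
  linarith
end

section
/- (Theorem 3, envy-freeness) Let (x, μ) be a Nash equilibrium, define payments w_{n,l} := Σ_{p∈P_l} x_n^p c^n_p(μ), and assume w_{n,l} > 0 for all n, l. For a nonnegative resource bundle a = (a_{i,r}) indexed by nodes and resources, let T_n(a; l) := sup { Σ_{p∈P_l} t_p : t_p ≥ 0 for all p ∈ P_l, and Σ_{p∈P_l : i∈p} t_p d^p_{n,i,r} ≤ a_{i,r} for all i, r } be the maximum traffic volume NSI n can process in area l with bundle a, and let a_{n,l} be the bundle with (a_{n,l})_{i,r} := Σ_{p∈P_l : i∈p} x_n^p d^p_{n,i,r}. Then for all NSIs n, m and every area l, T_n(a_{n,l}; l) ≥ T_n((w_{n,l}/w_{m,l}) · a_{m,l}; l); that is, no NSI prefers another NSI's allocated resources scaled by the ratio of their payments. -/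
open Finset

/-- Exchange of summation: payments are the value of the used bundle. -/
theorem cost_swap {A I R P : Type*} [Fintype I] [Fintype R] [Fintype P]
    [DecidableEq A] [DecidableEq I] (area : P → A) (nodes : P → Finset I)
    (d : P → I → R → ℝ) (μ : I → R → ℝ) (l : A) (t : P → ℝ) :
    ∑ p ∈ Finset.univ.filter (fun p => area p = l), t p * pathCost nodes d μ p =
      ∑ i, ∑ r, μ i r *
        ∑ p ∈ Finset.univ.filter (fun p => i ∈ nodes p ∧ area p = l), t p * d p i r := by
  have h1 : ∀ p, t p * pathCost nodes d μ p =
      ∑ i, ∑ r, (if i ∈ nodes p then μ i r * (t p * d p i r) else 0) := by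
    intro p
    unfold pathCost
    rw [Finset.mul_sum, ← Finset.sum_filter_add_sum_filter_not Finset.univ (fun i => i ∈ nodes p)]
    rw [Finset.sum_eq_zero (s := Finset.univ.filter (fun i => ¬ i ∈ nodes p))]
    · rw [add_zero, Finset.filter_mem_eq_inter, Finset.univ_inter]
      refine Finset.sum_congr rfl fun i hi => ?_
      rw [Finset.mul_sum]
      refine Finset.sum_congr rfl fun r _ => ?_
      rw [if_pos hi]; ring
    · intro i hi
      have := (Finset.mem_filter.1 hi).2
      simp [this]
  simp_rw [h1]
  rw [Finset.sum_comm]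
  refine Finset.sum_congr rfl fun i _ => ?_
  rw [Finset.sum_comm]
  refine Finset.sum_congr rfl fun r _ => ?_
  rw [Finset.mul_sum, ← Finset.sum_filter, Finset.filter_filter]
  refine Finset.sum_congr ?_ fun _ _ => rfl
  ext p; simp [and_comm]

/-- At a maximizer every path of the area costs at least the average cost paid. -/
theorem pay_le {A I R P : Type*} [Fintype A] [Fintype P] [Fintype R]
    [DecidableEq A] (area : P → A) (nodes : P → Finset I) (U : A → ℝ → ℝ)
    (d : P → I → R → ℝ) (μ : I → R → ℝ) (x : P → ℝ)
    (h : MaximizesPayoff area nodes U d μ x) (l : A) (p0 : P) (hp0 : area p0 = l) :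
    ∑ p ∈ Finset.univ.filter (fun p => area p = l), x p * pathCost nodes d μ p ≤
      areaVol area x l * pathCost nodes d μ p0 := by
  classical
  set X := areaVol area x l with hX
  have hX0 : 0 ≤ X := Finset.sum_nonneg fun p _ => h.1 p
  let y : P → ℝ := fun p => if area p = l then (if p = p0 then X else 0) else x p
  have hsum : ∀ f : P → ℝ, ∑ p ∈ Finset.univ.filter (fun p => area p = l), y p * f p
      = X * f p0 := by
    intro f
    rw [Finset.sum_eq_single p0]
    · simp [y, hp0]
    · intro p hp hne
      simp [y, hne, (Finset.mem_filter.1 hp).2]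
    · intro hn
      exact (hn (Finset.mem_filter.2 ⟨Finset.mem_univ _, hp0⟩)).elim
  have hother : ∀ (f : P → ℝ) (k : A), k ≠ l →
      ∑ p ∈ Finset.univ.filter (fun p => area p = k), y p * f p =
      ∑ p ∈ Finset.univ.filter (fun p => area p = k), x p * f p := by
    intro f k hk
    refine Finset.sum_congr rfl fun p hp => ?_
    have := (Finset.mem_filter.1 hp).2
    simp [y, this, hk]
  have hvol : ∀ k, areaVol area y k = areaVol area x k := by
    intro k
    by_cases hk : k = l
    · subst hk
      have := hsum (fun _ => 1)
      simp only [mul_one] at this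
      rw [areaVol, this]
    · have := hother (fun _ => 1) k hk
      simp only [mul_one] at this
      exact this
  have hy : ∀ p, 0 ≤ y p := by
    intro p
    simp only [y]
    split_ifs
    · exact hX0
    · exact le_rfl
    · exact h.1 p
  have hm := h.2 y hy
  unfold payoffNSI at hm
  simp only [hvol] at hm
  have hm2 := (sub_le_sub_iff_left _).1 hm
  rw [← Finset.add_sum_erase _ _ (Finset.mem_univ l),
    ← Finset.add_sum_erase Finset.univ
      (fun k => ∑ p ∈ Finset.univ.filter (fun p => area p = k), y p * pathCost nodes d μ p)
      (Finset.mem_univ l)] at hm2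
  rw [Finset.sum_congr rfl (fun k hk => hother (pathCost nodes d μ) k (Finset.ne_of_mem_erase hk))]
    at hm2
  have := le_of_add_le_add_right hm2
  rwa [hsum] at this

theorem statement12 {N A I R P : Type*} [Fintype N] [Fintype A] [Fintype I] [Fintype R] [Fintype P]
    [Nonempty N] [Nonempty A] [Nonempty I] [Nonempty R]
    [DecidableEq A] [DecidableEq I]
    (area : P → A) (nodes : P → Finset I)
    (d : N → P → I → R → ℝ) (C q : I → R → ℝ)
    (U U' : N → A → ℝ → ℝ)
    (hP : ∀ l : A, ∃ p : P, area p = l)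
    (hd : ∀ n p i r, 0 ≤ d n p i r)
    (hC : ∀ i r, 0 < C i r)
    (hq : ∀ i r, 0 ≤ q i r)
    (hU : ∀ n l, StrictConcaveOn ℝ (Set.Ici (0 : ℝ)) (U n l))
    (hU' : ∀ n l z, (0 : ℝ) ≤ z → HasDerivWithinAt (U n l) (U' n l z) (Set.Ici 0) z)
    (hU'c : ∀ n l, ContinuousOn (U' n l) (Set.Ici 0))
    (x : N → P → ℝ) (μ : I → R → ℝ) (hNE : IsNE area nodes U d C q x μ)
    (w : N → A → ℝ)
    (hwdef : ∀ n l, w n l =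
      ∑ p ∈ Finset.univ.filter (fun p => area p = l),
        x n p * pathCost nodes (d n) μ p)
    (hwpos : ∀ n l, 0 < w n l)
    (a : N → A → I → R → ℝ)
    (hadef : ∀ n l i r, a n l i r =
      ∑ p ∈ Finset.univ.filter (fun p => i ∈ nodes p ∧ area p = l),
        x n p * d n p i r) :
    ∀ (n m : N) (l : A),
      Tvol area nodes (d n) l (fun i r => w n l / w m l * a m l i r) ≤
        Tvol area nodes (d n) l (a n l) := by
  intro n m l
  obtain ⟨-, hμ, -, -, hmax⟩ := hNE
  have hx := (hmax n).1
  have hval : ∀ k, ∑ i, ∑ r, μ i r * a k l i r = w k l := by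
    intro k
    rw [hwdef, cost_swap]
    simp only [hadef]
  have hX0 : 0 ≤ areaVol area (x n) l := Finset.sum_nonneg fun p _ => hx p
  -- any volume processed with a bundle of value `w n l` is at most the equilibrium volume
  have key : ∀ b : I → R → ℝ, ∑ i, ∑ r, μ i r * b i r = w n l → ∀ t : P → ℝ, (∀ p, 0 ≤ t p) →
      (∀ i r, (∑ p ∈ Finset.univ.filter (fun p => i ∈ nodes p ∧ area p = l),
        t p * d n p i r) ≤ b i r) →
      ∑ p ∈ Finset.univ.filter (fun p => area p = l), t p ≤ areaVol area (x n) l := by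
    intro b hb t ht hle
    have h1 : ∑ p ∈ Finset.univ.filter (fun p => area p = l), t p * pathCost nodes (d n) μ p
        ≤ w n l := by
      rw [cost_swap, ← hb]
      exact Finset.sum_le_sum fun i _ => Finset.sum_le_sum fun r _ =>
        mul_le_mul_of_nonneg_left (hle i r) (hμ i r)
    have h2 : (∑ p ∈ Finset.univ.filter (fun p => area p = l), t p) * w n l ≤
        areaVol area (x n) l *
        ∑ p ∈ Finset.univ.filter (fun p => area p = l), t p * pathCost nodes (d n) μ p := by
      rw [Finset.sum_mul, Finset.mul_sum]
      refine Finset.sum_le_sum fun p hp => ?_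
      have := pay_le area nodes (U n) (d n) μ (x n) (hmax n) l p (Finset.mem_filter.1 hp).2
      rw [← hwdef] at this
      calc t p * w n l ≤ t p * (areaVol area (x n) l * pathCost nodes (d n) μ p) :=
            mul_le_mul_of_nonneg_left this (ht p)
        _ = _ := by ring
    exact le_of_mul_le_mul_right (h2.trans (mul_le_mul_of_nonneg_left h1 hX0)) (hwpos n l)
  have hle : Tvol area nodes (d n) l (fun i r => w n l / w m l * a m l i r) ≤
      areaVol area (x n) l := by
    refine Real.sSup_le ?_ hX0
    rintro s ⟨t, ht, hb, rfl⟩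
    refine key _ ?_ t ht hb
    have : ∀ i r, μ i r * (w n l / w m l * a m l i r) = w n l / w m l * (μ i r * a m l i r) :=
      fun i r => by ring
    simp only [this, ← Finset.mul_sum, hval]
    exact div_mul_cancel₀ _ (hwpos m l).ne'
  refine hle.trans (le_csSup ?_ ?_)
  · refine ⟨areaVol area (x n) l, ?_⟩
    rintro s ⟨t, ht, hb, rfl⟩
    exact key _ (hval n) t ht hb
  · exact ⟨x n, hx, fun i r => (hadef n l i r).ge, rfl⟩
end

section
/- (Theorem 3, sharing incentive, per-path form) Let (x, μ) be a Nash equilibrium. Define per-node payments w^p_{n,i} := x_n^p Σ_r μ_{i,r} d^p_{n,i,r}, node revenues W_i := Σ_m Σ_{p' : i∈p'} w^{p'}_{m,i}, utilized amounts η_{i,r} C_{i,r} := Σ_m Σ_{p' : i∈p'} x_m^{p'} d^{p'}_{m,i,r}, and for each path p and node i ∈ p the monopolized volume γ^p_{n,i} := min over resources r with d^p_{n,i,r} > 0 of (η_{i,r} C_{i,r})/d^p_{n,i,r}. Fix an NSI n, an area l, and a path p ∈ P_l such that: w^p_n := Σ_{i∈p} w^p_{n,i} > 0, W_i > 0 for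 every i ∈ p, and for every i ∈ p there exists a resource r with d^p_{n,i,r} > 0. Then x_n^p ≥ x^{p,uni}_n := min_{i∈p} (w^p_{n,i}/W_i) · γ^p_{n,i}; that is, each NSI forwards at least as much traffic over each paid-for path as under the uniform allocation. -/
open Finset

theorem statement13 {N A I R P : Type*} [Fintype N] [Fintype A] [Fintype I] [Fintype R] [Fintype P]
    [Nonempty N] [Nonempty A] [Nonempty I] [Nonempty R]
    [DecidableEq A] [DecidableEq I]
    (area : P → A) (nodes : P → Finset I)
    (d : N → P → I → R → ℝ) (C q : I → R → ℝ)
    (U U' : N → A → ℝ → ℝ)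
    (hP : ∀ l : A, ∃ p : P, area p = l)
    (hd : ∀ n p i r, 0 ≤ d n p i r)
    (hC : ∀ i r, 0 < C i r)
    (hq : ∀ i r, 0 ≤ q i r)
    (hU : ∀ n l, StrictConcaveOn ℝ (Set.Ici (0 : ℝ)) (U n l))
    (hU' : ∀ n l z, (0 : ℝ) ≤ z → HasDerivWithinAt (U n l) (U' n l z) (Set.Ici 0) z)
    (hU'c : ∀ n l, ContinuousOn (U' n l) (Set.Ici 0))
    (x : N → P → ℝ) (μ : I → R → ℝ) (hNE : IsNE area nodes U d C q x μ)
    (wpn : N → P → I → ℝ)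
    (hwpn : ∀ n p i, wpn n p i = x n p * ∑ r, μ i r * d n p i r)
    (W : I → ℝ)
    (hW : ∀ i, W i =
      ∑ m, ∑ p' ∈ Finset.univ.filter (fun p' => i ∈ nodes p'), wpn m p' i)
    (u : I → R → ℝ) (hu : ∀ i r, u i r = nodeLoad nodes d x i r)
    (n : N) (l : A) (p : P) (hp : area p = l)
    (γ : I → ℝ)
    (hγ : ∀ i ∈ nodes p,
      (∀ r : R, 0 < d n p i r → γ i ≤ u i r / d n p i r) ∧
        ∃ r : R, 0 < d n p i r ∧ γ i = u i r / d n p i r)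
    (hwp : 0 < ∑ i ∈ nodes p, wpn n p i)
    (hWpos : ∀ i ∈ nodes p, 0 < W i)
    (hpne : (nodes p).Nonempty) :
    (nodes p).inf' hpne (fun i => wpn n p i / W i * γ i) ≤ x n p := by
  obtain ⟨⟨hx, -⟩, hμ, -⟩ := hNE
  obtain ⟨i, hi⟩ := hpne
  refine (Finset.inf'_le _ hi).trans ?_
  have hWi := hWpos i hi
  have hWu : W i = ∑ r, μ i r * u i r := by
    rw [hW i]
    simp only [hu, hwpn, nodeLoad, Finset.mul_sum]
    conv_rhs => rw [Finset.sum_comm]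
    refine Finset.sum_congr rfl fun m _ => ?_
    conv_rhs => rw [Finset.sum_comm]
    refine Finset.sum_congr rfl fun p' _ => Finset.sum_congr rfl fun r _ => ?_
    ring
  have hu0 : ∀ r, 0 ≤ u i r := fun r => by
    rw [hu]
    exact Finset.sum_nonneg fun m _ => Finset.sum_nonneg fun p' _ =>
      mul_nonneg (hx m p') (hd m p' i r)
  have key : (∑ r, μ i r * d n p i r) * γ i ≤ W i := by
    rw [hWu, Finset.sum_mul]
    refine Finset.sum_le_sum fun r _ => ?_
    rw [mul_assoc]
    refine mul_le_mul_of_nonneg_left ?_ (hμ i r)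
    rcases (hd n p i r).eq_or_lt with h | h
    · rw [← h, zero_mul]
      exact hu0 r
    · have h2 := (hγ i hi).1 r h
      rw [le_div_iff₀ h] at h2
      linarith
  change wpn n p i / W i * γ i ≤ x n p
  rw [div_mul_eq_mul_div, div_le_iff₀ hWi, hwpn, mul_assoc]
  exact mul_le_mul_of_nonneg_left key (hx n p)
end

section
/- (Theorem 3, sharing incentive, area form) Let (x, μ) be a Nash equilibrium, with per-node payments w^p_{n,i} := x_n^p Σ_r μ_{i,r} d^p_{n,i,r}, node revenues W_i := Σ_m Σ_{p' : i∈p'} w^{p'}_{m,i}, utilized amounts η_{i,r} C_{i,r} := Σ_m Σ_{p' : i∈p'} x_m^{p'} d^{p'}_{m,i,r}, monopolized volumes γ^p_{n,i} := min over resources r with d^p_{n,i,r} > 0 of (η_{i,r} C_{i,r})/d^p_{n,i,r}, and uniform-allocation volumes x^{p,uni}_n := min_{i∈p} (w^p_{n,i}/W_i) · γ^p_{n,i}. Fix an NSI n and an area l, and assume that for every path p ∈ P_l and every node i ∈ p: W_i > 0 and there exists a resource r with d^p_{n,i,r} > 0, and that for every p ∈ P_l either x_n^p > 0 or x^{p,uni}_n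 = 0 is replaced by noting that x_n^p = 0 forces w^p_{n,i} = 0 and hence x^{p,uni}_n = 0. Then x_{n,l} ≥ Σ_{p∈P_l} x^{p,uni}_n; that is, each NSI is provisioned at least as much total traffic in each area as under the uniform allocation. -/
open Finset

theorem statement14 {N A I R P : Type*} [Fintype N] [Fintype A] [Fintype I] [Fintype R] [Fintype P]
    [Nonempty N] [Nonempty A] [Nonempty I] [Nonempty R]
    [DecidableEq A] [DecidableEq I]
    (area : P → A) (nodes : P → Finset I)
    (d : N → P → I → R → ℝ) (C q : I → R → ℝ)
    (U U' : N → A → ℝ → ℝ)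
    (hP : ∀ l : A, ∃ p : P, area p = l)
    (hd : ∀ n p i r, 0 ≤ d n p i r)
    (hC : ∀ i r, 0 < C i r)
    (hq : ∀ i r, 0 ≤ q i r)
    (hU : ∀ n l, StrictConcaveOn ℝ (Set.Ici (0 : ℝ)) (U n l))
    (hU' : ∀ n l z, (0 : ℝ) ≤ z → HasDerivWithinAt (U n l) (U' n l z) (Set.Ici 0) z)
    (hU'c : ∀ n l, ContinuousOn (U' n l) (Set.Ici 0))
    (x : N → P → ℝ) (μ : I → R → ℝ) (hNE : IsNE area nodes U d C q x μ)
    (wpn : N → P → I → ℝ)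
    (hwpn : ∀ n p i, wpn n p i = x n p * ∑ r, μ i r * d n p i r)
    (W : I → ℝ)
    (hW : ∀ i, W i =
      ∑ m, ∑ p' ∈ Finset.univ.filter (fun p' => i ∈ nodes p'), wpn m p' i)
    (u : I → R → ℝ) (hu : ∀ i r, u i r = nodeLoad nodes d x i r)
    (n : N) (l : A)
    (γ : P → I → ℝ)
    (hγ : ∀ p : P, area p = l → ∀ i ∈ nodes p,
      (∀ r : R, 0 < d n p i r → γ p i ≤ u i r / d n p i r) ∧
        ∃ r : R, 0 < d n p i r ∧ γ p i = u i r / d n p i r)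
    (hWpos : ∀ p : P, area p = l → ∀ i ∈ nodes p, 0 < W i)
    (xuni : P → ℝ)
    (hxuni : ∀ p : P, area p = l →
      (∀ i ∈ nodes p, xuni p ≤ wpn n p i / W i * γ p i) ∧
        ∃ i ∈ nodes p, xuni p = wpn n p i / W i * γ p i) :
    (∑ p ∈ Finset.univ.filter (fun p => area p = l), xuni p) ≤
      areaVol area (x n) l := by
  obtain ⟨⟨hx, -⟩, hμ, -, -, -⟩ := hNE
  have hWu : ∀ i, W i = ∑ r, μ i r * u i r := by
    intro i
    rw [hW]
    simp only [hwpn, hu, nodeLoad, Finset.mul_sum]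
    rw [Finset.sum_comm]
    conv_rhs => rw [Finset.sum_comm]
    rw [Finset.sum_comm]
    refine Finset.sum_congr rfl fun m _ => ?_
    conv_rhs => rw [Finset.sum_comm]
    refine Finset.sum_congr rfl fun p _ => ?_
    refine Finset.sum_congr rfl fun r _ => ?_
    ring
  have hu0 : ∀ i r, 0 ≤ u i r := by
    intro i r
    rw [hu]
    exact Finset.sum_nonneg fun m _ => Finset.sum_nonneg fun p _ =>
      mul_nonneg (hx m p) (hd m p i r)
  unfold areaVol
  refine Finset.sum_le_sum fun p hp => ?_
  have hpl : area p = l := (Finset.mem_filter.mp hp).2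
  obtain ⟨i, hi, hxi⟩ := (hxuni p hpl).2
  have hWi := hWpos p hpl i hi
  have hg : γ p i * ∑ r, μ i r * d n p i r ≤ W i := by
    rw [hWu, Finset.mul_sum]
    refine Finset.sum_le_sum fun r _ => ?_
    have h1 : γ p i * d n p i r ≤ u i r := by
      rcases (hd n p i r).eq_or_lt with h | h
      · rw [← h, mul_zero]
        exact hu0 i r
      · exact (le_div_iff₀ h).mp ((hγ p hpl i hi).1 r h)
    calc γ p i * (μ i r * d n p i r) = μ i r * (γ p i * d n p i r) := by ring
      _ ≤ μ i r * u i r := mul_le_mul_of_nonneg_left h1 (hμ i r)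
  rw [hxi, hwpn, div_mul_eq_mul_div, div_le_iff₀ hWi]
  calc x n p * (∑ r, μ i r * d n p i r) * γ p i
      = x n p * (γ p i * ∑ r, μ i r * d n p i r) := by ring
    _ ≤ x n p * W i := mul_le_mul_of_nonneg_left hg (hx n p)
end
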